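/- There are absolute constants c0, c1, c2, η, C > 0 such that the following holds. Let 0 < δ ≤ c0, set ε = c·δ/log(e/δ) for a suitable absolute constant c, let r ∈ ℕ, let I = {1,…,r} and J = {r+1,…,⌊ηr/ε²⌋}, let n = |I|+|J|, and set E = {(x,y) : x ∈ B₂^I, y ∈ ε·B₂^J} ⊆ ℝ^n. Let λ = C·√(log(e/δ)), let A : ℝ^n → ℝ^m be a standard gaussian matrix, let τ be uniformly distributed in [−λ,λ]^m independent of A, and let f(t) = sign(At+τ). Then: (1) if m ≤ c1·√(log(e/δ))·ℓ_*²(E)/δ³, with probability at least 0.9 there exist x, y ∈ E with | (√(2π)·λ/m)·d_H(f(x),f(y)) − ‖x−y‖₂ | ≥ 2δ; and (2) if m ≥ c2·√(log(e/δ))·ℓ_*²(E)/δ³, with probability at least 0.9, sup_{x,y∈E} | (√(2π)·λ/m)·d_H(f(x),f(y)) − ‖x−y‖₂ | ≤ δ. -/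

import Mathlib

open MeasureTheory ProbabilityTheory Real

noncomputable section

/-- Euclidean norm on `Fin n → ℝ`. -/
def enorm2 {n : ℕ} (x : Fin n → ℝ) : ℝ := Real.sqrt (∑ i, (x i)^2)

/-- Euclidean inner product. -/
def ip {n : ℕ} (x y : Fin n → ℝ) : ℝ := ∑ i, x i * y i

/-- sign function with values in {-1,1}. -/
def signPM (s : ℝ) : ℝ := if 0 ≤ s then 1 else -1

/-- componentwise sign. -/
def signVec {m : ℕ} (v : Fin m → ℝ) : Fin m → ℝ := fun i => signPM (v i)

/-- Hamming distance. -/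
def hamming {m : ℕ} (u v : Fin m → ℝ) : ℕ := (Finset.univ.filter fun i => u i ≠ v i).card

def mulVecR {m n : ℕ} (A : Fin m → Fin n → ℝ) (x : Fin n → ℝ) : Fin m → ℝ :=
  fun i => ∑ j, A i j * x j

def l1norm {m : ℕ} (v : Fin m → ℝ) : ℝ := ∑ i, |v i|

/-- the norm ‖v‖_{[s]}. -/
def knorm {m : ℕ} (s : ℕ) (v : Fin m → ℝ) : ℝ :=
  sSup {r | ∃ I : Finset (Fin m), I.card = s ∧ r = Real.sqrt (∑ i ∈ I, (v i)^2)}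

/-- standard gaussian measure on ℝ^n. -/
def gaussianPi (n : ℕ) : Measure (Fin n → ℝ) := Measure.pi fun _ => gaussianReal 0 1

instance (n : ℕ) : IsProbabilityMeasure (gaussianPi n) := by
  unfold gaussianPi; infer_instance

/-- standard gaussian m × n matrix distribution (rows). -/
def gaussianMatrix (m n : ℕ) : Measure (Fin m → Fin n → ℝ) := Measure.pi fun _ => gaussianPi n

instance (m n : ℕ) : IsProbabilityMeasure (gaussianMatrix m n) := by
  unfold gaussianMatrix; infer_instance

/-- uniform distribution on the cube [-λ,λ]^m. -/
def unifCube (m : ℕ) (lam : ℝ) : Measure (Fin m → ℝ) :=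
  (ENNReal.ofReal ((2*lam)^m))⁻¹ • volume.restrict (Set.univ.pi fun _ => Set.Icc (-lam) lam)

instance (m : ℕ) (lam : ℝ) : SFinite (unifCube m lam) := by
  unfold unifCube; infer_instance

/-- gaussian mean width. -/
def meanWidth {n : ℕ} (T : Set (Fin n → ℝ)) : ℝ :=
  ∫ g, sSup ((fun t => |ip g t|) '' T) ∂(gaussianPi n)

/-- Dvoretzky–Milman dimension. -/
def dstar {n : ℕ} (T : Set (Fin n → ℝ)) : ℝ :=
  (meanWidth T / sSup (enorm2 '' T))^2

/-- covering number. -/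
def coveringNumber {n : ℕ} (T : Set (Fin n → ℝ)) (θ : ℝ) : ℕ :=
  sInf {N : ℕ | ∃ F : Finset (Fin n → ℝ), F.card = N ∧ T ⊆ ⋃ c ∈ F, {x | enorm2 (x - c) < θ}}

/-- the difference set T - T. -/
def diffSet {n : ℕ} (T : Set (Fin n → ℝ)) : Set (Fin n → ℝ) :=
  {z | ∃ a ∈ T, ∃ b ∈ T, z = a - b}

/-- closed euclidean ball of radius r. -/
def ballE (n : ℕ) (r : ℝ) : Set (Fin n → ℝ) := {z | enorm2 z ≤ r}

/-- The set E = B₂^I × (ε·B₂^J), where I = {1,…,r} and J = {r+1,…,n} are the first r and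
remaining coordinates of ℝ^n. -/
def cylSet (n r : ℕ) (ε : ℝ) : Set (Fin n → ℝ) :=
  {x | Real.sqrt (∑ i ∈ Finset.univ.filter (fun i : Fin n => (i : ℕ) < r), (x i)^2) ≤ 1 ∧
       Real.sqrt (∑ i ∈ Finset.univ.filter (fun i : Fin n => r ≤ (i : ℕ)), (x i)^2) ≤ ε}

lemma enorm2_nonneg {n : ℕ} (x : Fin n → ℝ) : 0 ≤ enorm2 x := Real.sqrt_nonneg _

lemma enorm2_sq {n : ℕ} (x : Fin n → ℝ) : enorm2 x ^ 2 = ∑ i, (x i) ^ 2 :=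
  Real.sq_sqrt (Finset.sum_nonneg fun _ _ => sq_nonneg _)

lemma measurable_ip {n : ℕ} (x : Fin n → ℝ) : Measurable fun g : Fin n → ℝ => ip g x := by
  unfold ip; fun_prop

/-- The law of a linear functional of a standard gaussian vector. -/
lemma gaussianPi_map_ip {n : ℕ} (x : Fin n → ℝ) :
    (gaussianPi n).map (fun g => ip g x) = gaussianReal 0 (enorm2 x ^ 2).toNNReal := by
  have hm := measurable_ip x
  have : IsProbabilityMeasure ((gaussianPi n).map (fun g => ip g x)) :=
    Measure.isProbabilityMeasure_map hm.aemeasurable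
  apply Measure.ext_of_charFun
  ext t
  rw [charFun_gaussianReal, charFun_apply_real, integral_map hm.aemeasurable (by fun_prop)]
  have h1 : ∀ g : Fin n → ℝ, Complex.exp (t * (ip g x : ℝ) * Complex.I)
      = ∏ i, Complex.exp ((t * x i : ℝ) * (g i : ℂ) * Complex.I) := by
    intro g
    rw [← Complex.exp_sum]
    congr 1
    unfold ip
    push_cast
    rw [Finset.mul_sum, Finset.sum_mul]
    exact Finset.sum_congr rfl fun i _ => by ring
  simp_rw [h1]
  unfold gaussianPi
  rw [integral_fintype_prod_eq_prod
    (f := fun i (y : ℝ) => Complex.exp ((t * x i : ℝ) * (y : ℂ) * Complex.I))]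
  simp_rw [← charFun_apply_real, charFun_gaussianReal]
  rw [← Complex.exp_sum, Real.coe_toNNReal _ (sq_nonneg _), enorm2_sq]
  congr 1
  push_cast
  simp only [mul_zero, zero_mul, zero_sub, one_mul, Finset.sum_neg_distrib, ← Finset.sum_div,
    Finset.sum_mul]
  congr 2
  exact Finset.sum_congr rfl fun i _ => by ring

/-- Scaling to the standard gaussian. -/
lemma gaussianReal_eq_map_scale {s : ℝ} :
    gaussianReal 0 (s ^ 2).toNNReal = (gaussianReal 0 1).map (fun y => s * y) := by
  rw [gaussianReal_map_const_mul]
  congr 1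
  · simp
  · ext; simp [Real.coe_toNNReal _ (sq_nonneg s)]

lemma integral_gaussianPi_comp_ip {n : ℕ} (x : Fin n → ℝ) {φ : ℝ → ℝ} (hφ : Measurable φ) :
    ∫ g, φ (ip g x) ∂(gaussianPi n) = ∫ y, φ (enorm2 x * y) ∂(gaussianReal 0 1) := by
  rw [← integral_map (f := φ) (measurable_ip x).aemeasurable hφ.aestronglyMeasurable,
    gaussianPi_map_ip, gaussianReal_eq_map_scale,
    integral_map (by fun_prop) hφ.aestronglyMeasurable]

lemma integrable_gaussianPi_comp_ip {n : ℕ} (x : Fin n → ℝ) {φ : ℝ → ℝ} (hφ : Measurable φ)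
    (h : Integrable (fun y => φ (enorm2 x * y)) (gaussianReal 0 1)) :
    Integrable (fun g => φ (ip g x)) (gaussianPi n) := by
  have h2 : Integrable φ ((gaussianPi n).map (fun g => ip g x)) := by
    rw [gaussianPi_map_ip, gaussianReal_eq_map_scale,
      integrable_map_measure hφ.aestronglyMeasurable (by fun_prop)]
    exact h
  exact h2.comp_measurable (measurable_ip x)

lemma integrable_pow_gaussianReal (k : ℕ) :
    Integrable (fun y : ℝ => y ^ k) (gaussianReal 0 1) := by
  have h := (memLp_id_gaussianReal (μ := 0) (v := 1) (k : NNReal)).integrable_norm_pow'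
  refine h.mono' (by fun_prop) (Filter.Eventually.of_forall fun y => ?_)
  simp

lemma integrable_exp_sq_div_four :
    Integrable (fun y : ℝ => Real.exp (y ^ 2 / 4)) (gaussianReal 0 1) := by
  rw [gaussianReal_of_var_ne_zero _ one_ne_zero,
    integrable_withDensity_iff_integrable_smul₀' (by fun_prop) (by simp [gaussianPDF_lt_top])]
  have := integrable_exp_neg_mul_sq (b := 1 / 4) (by norm_num)
  refine (this.const_mul (√(2 * π))⁻¹).congr (Filter.Eventually.of_forall fun y => ?_)
  simp only [toReal_gaussianPDF, gaussianPDFReal, NNReal.coe_one, smul_eq_mul, mul_one]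
  rw [mul_assoc, ← Real.exp_add]
  congr 2
  ring

lemma integral_exp_sq_div_four :
    ∫ y, Real.exp (y ^ 2 / 4) ∂(gaussianReal 0 1) = √2 := by
  rw [integral_gaussianReal_eq_integral_smul one_ne_zero]
  have h1 : ∀ y : ℝ, gaussianPDFReal 0 1 y • Real.exp (y ^ 2 / 4)
      = (√(2 * π))⁻¹ * Real.exp (-(1 / 4) * y ^ 2) := by
    intro y
    simp only [gaussianPDFReal, NNReal.coe_one, smul_eq_mul, mul_one]
    rw [mul_assoc, ← Real.exp_add]
    congr 2
    ring
  simp_rw [h1]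
  rw [integral_const_mul, integral_gaussian, show π / (1 / 4) = 2 * (2 * π) by ring,
    Real.sqrt_mul (by norm_num) (2 * π)]
  have : √(2 * π) ≠ 0 := by positivity
  field_simp

lemma integral_abs_gaussianReal : ∫ y, |y| ∂(gaussianReal 0 1) = √(2 / π) := by
  rw [integral_gaussianReal_eq_integral_smul one_ne_zero]
  have h1 : ∀ y : ℝ, gaussianPDFReal 0 1 y • |y|
      = (fun z => (√(2 * π))⁻¹ * (z * Real.exp (-(1 / 2) * z ^ 2))) |y| := by
    intro y
    simp only [gaussianPDFReal, NNReal.coe_one, smul_eq_mul, mul_one, sq_abs]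
    rw [show -(y - 0) ^ 2 / 2 = -(1 / 2) * y ^ 2 by ring]
    ring
  simp_rw [h1]
  rw [integral_comp_abs (f := fun z => (√(2 * π))⁻¹ * (z * Real.exp (-(1 / 2) * z ^ 2))),
    integral_const_mul]
  have h2 := integral_rpow_mul_exp_neg_mul_rpow (p := 2) (q := 1) (b := 1 / 2)
    (by norm_num) (by norm_num) (by norm_num)
  have h3 : ∫ x in Set.Ioi (0 : ℝ), x * Real.exp (-(1 / 2) * x ^ 2) = 1 := by
    have e : ∀ x : ℝ, x * Real.exp (-(1 / 2) * x ^ 2)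
      = x ^ (1 : ℝ) * Real.exp (-(1 / 2) * x ^ (2 : ℝ)) := by
      intro x; rw [Real.rpow_one, Real.rpow_two]
    simp_rw [e, h2]
    norm_num [Real.rpow_neg_one]
  rw [h3, Real.sqrt_div (by norm_num), Real.sqrt_mul (by norm_num)]
  have : √π ≠ 0 := by positivity
  have h4 : √2 * √2 = 2 := Real.mul_self_sqrt (by norm_num)
  have h5 : √2 ≠ 0 := by positivity
  field_simp
  nlinarith

lemma integral_sq_gaussianReal : ∫ y, y ^ 2 ∂(gaussianReal 0 1) = 1 := by
  have h := variance_fun_id_gaussianReal (μ := 0) (v := 1)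
  rw [variance_eq_integral (by fun_prop)] at h
  simpa [integral_id_gaussianReal] using h

lemma integral_pow_four_gaussianReal_le : ∫ y, y ^ 4 ∂(gaussianReal 0 1) ≤ 80 := by
  have hb : ∀ t : ℝ, ∫ y, Real.exp (t * y) ∂(gaussianReal 0 1) = Real.exp (t ^ 2 / 2) := by
    intro t
    have := congrFun (mgf_id_gaussianReal (μ := 0) (v := 1)) t
    simpa [mgf] using this
  have hi : ∀ t : ℝ, Integrable (fun y => Real.exp (t * y)) (gaussianReal 0 1) :=
    fun t => integrable_exp_mul_gaussianReal t
  calc ∫ y, y ^ 4 ∂(gaussianReal 0 1)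
      ≤ ∫ y, (24 * Real.exp (1 * y) + 24 * Real.exp (-1 * y)) ∂(gaussianReal 0 1) := by
        refine integral_mono (integrable_pow_gaussianReal 4)
          (((hi 1).const_mul 24).add ((hi (-1)).const_mul 24)) fun y => ?_
        have h1 := Real.pow_div_factorial_le_exp |y| (abs_nonneg y) 4
        have h2 : |y| ^ 4 = y ^ 4 := by rw [← abs_pow, abs_of_nonneg (by positivity)]
        rw [h2] at h1
        have h3 : Real.exp |y| ≤ Real.exp y + Real.exp (-y) := by
          rcases abs_cases y with ⟨h, _⟩ | ⟨h, _⟩ <;> rw [h] <;>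
            linarith [Real.exp_pos y, Real.exp_pos (-y)]
        norm_num [Nat.factorial] at h1 ⊢
        linarith
    _ = 48 * Real.exp (1 / 2) := by
        rw [integral_add ((hi 1).const_mul 24) ((hi (-1)).const_mul 24), integral_const_mul,
          integral_const_mul, hb, hb]
        norm_num
        ring
    _ ≤ 80 := by
        have h : Real.exp (1 / 2) ^ 2 ≤ (80 / 48) ^ 2 := by
          rw [← Real.exp_nat_mul]
          norm_num
          linarith [Real.exp_one_lt_d9]
        linarith [abs_le_of_sq_le_sq h (by norm_num), le_abs_self (Real.exp (1 / 2))]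

/-- Truncation error of a centred gaussian with standard deviation at most one. -/
lemma integral_gaussian_excess_le {s lam : ℝ} (hs : 0 ≤ s) (hs1 : s ≤ 1) (hl : 0 < lam) :
    Integrable (fun y => max (|s * y| - lam) 0) (gaussianReal 0 1) ∧
    ∫ y, max (|s * y| - lam) 0 ∂(gaussianReal 0 1) ≤ 2 * Real.exp (-lam ^ 2 / 2) / lam := by
  have hb : ∀ t : ℝ, ∫ y, Real.exp (t * y) ∂(gaussianReal 0 1) = Real.exp (t ^ 2 / 2) := by
    intro t
    have := congrFun (mgf_id_gaussianReal (μ := 0) (v := 1)) t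
    simpa [mgf] using this
  have hi : ∀ t : ℝ, Integrable (fun y => Real.exp (t * y)) (gaussianReal 0 1) :=
    fun t => integrable_exp_mul_gaussianReal t
  set K := Real.exp (-lam ^ 2) / lam with hK
  have hK0 : 0 < K := by positivity
  have hI : Integrable (fun y => K * Real.exp ((lam * s) * y) + K * Real.exp ((-(lam * s)) * y))
      (gaussianReal 0 1) := ((hi _).const_mul K).add ((hi _).const_mul K)
  have hle : ∀ y : ℝ, max (|s * y| - lam) 0 ≤
      K * Real.exp ((lam * s) * y) + K * Real.exp ((-(lam * s)) * y) := by
    intro y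
    refine max_le ?_ (by positivity)
    have h1 : lam * (|s * y| - lam) ≤ Real.exp (lam * (|s * y| - lam)) := by
      linarith [Real.add_one_le_exp (lam * (|s * y| - lam))]
    have h2 : Real.exp (lam * (|s * y| - lam)) =
        Real.exp (-lam ^ 2) * Real.exp (lam * |s * y|) := by
      rw [← Real.exp_add]; congr 1; ring
    have h3 : Real.exp (lam * |s * y|) ≤
        Real.exp ((lam * s) * y) + Real.exp ((-(lam * s)) * y) := by
      rcases abs_cases (s * y) with ⟨h, _⟩ | ⟨h, _⟩ <;> rw [h]
      · rw [show lam * (s * y) = lam * s * y by ring]; linarith [Real.exp_pos ((-(lam * s)) * y)]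
      · rw [show lam * -(s * y) = -(lam * s) * y by ring]; linarith [Real.exp_pos ((lam * s) * y)]
    rw [← mul_add, hK, div_mul_eq_mul_div, le_div_iff₀ hl]
    calc (|s * y| - lam) * lam = lam * (|s * y| - lam) := by ring
      _ ≤ _ := h1
      _ = _ := h2
      _ ≤ _ := by gcongr
  have hint : Integrable (fun y => max (|s * y| - lam) 0) (gaussianReal 0 1) := by
    refine hI.mono' (by fun_prop) (Filter.Eventually.of_forall fun y => ?_)
    rw [Real.norm_of_nonneg (le_max_right _ _)]
    exact hle y
  refine ⟨hint, ?_⟩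
  calc _ ≤ _ := integral_mono hint hI hle
    _ = 2 * (K * Real.exp ((lam * s) ^ 2 / 2)) := by
        rw [integral_add ((hi _).const_mul K) ((hi _).const_mul K), integral_const_mul,
          integral_const_mul, hb, hb]
        ring_nf
    _ ≤ 2 * (K * Real.exp (lam ^ 2 / 2)) := by
        gcongr
        have : s ^ 2 ≤ 1 := by nlinarith
        nlinarith [sq_nonneg lam]
    _ = _ := by
        rw [hK, div_mul_eq_mul_div, ← Real.exp_add]
        ring_nf

/-- A standard gaussian matrix has the same law as its transpose. -/
lemma gaussianMatrix_map_transpose (m n : ℕ) :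
    MeasurePreserving (fun (A : Fin m → Fin n → ℝ) (j : Fin n) (i : Fin m) => A i j)
      (gaussianMatrix m n) (gaussianMatrix n m) := by
  have key : ∀ a b : ℕ, gaussianMatrix a b =
      (Measure.pi (fun _ : Fin a × Fin b => gaussianReal 0 1)).map
      (MeasurableEquiv.curry (Fin a) (Fin b) ℝ) := by
    intro a b
    have := Measure.infinitePi_map_curry (ι := Fin a) (κ := Fin b) (fun _ _ => gaussianReal 0 1)
    simp only [Measure.infinitePi_eq_pi] at this
    exact this.symm
  refine ⟨by fun_prop, ?_⟩
  rw [key m n, key n m, Measure.map_map (by fun_prop) (by fun_prop)]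
  have h2 := Measure.pi_map_piCongrLeft (Equiv.prodComm (Fin m) (Fin n)) (β := fun _ => ℝ)
    (fun _ => gaussianReal 0 1)
  rw [← h2, Measure.map_map (by fun_prop) (by fun_prop)]
  congr 1

/-- Volumetric bound for separated subsets of the unit ball. -/
lemma card_le_of_separated_unitBall {E : Type*} [NormedAddCommGroup E] [NormedSpace ℝ E]
    [FiniteDimensional ℝ E] {ρ : ℝ} (hρ : 0 < ρ) (hρ1 : ρ ≤ 1) (s : Finset E)
    (hs : ∀ c ∈ s, ‖c‖ ≤ 1) (h : ∀ c ∈ s, ∀ d ∈ s, c ≠ d → ρ ≤ ‖c - d‖) :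
    (s.card : ℝ) ≤ (3 / ρ) ^ Module.finrank ℝ E := by
  borelize E
  let μ : Measure E := Measure.addHaar
  have D : Set.Pairwise (s : Set E)
      (Function.onFun Disjoint fun c => Metric.ball (c : E) (ρ / 2)) := by
    intro c hc d hd hcd
    apply Metric.ball_disjoint_ball
    rw [dist_eq_norm, add_halves]
    exact h c hc d hd hcd
  have A_subset : (⋃ c ∈ s, Metric.ball (c : E) (ρ / 2)) ⊆ Metric.ball (0 : E) (3 / 2) := by
    refine Set.iUnion₂_subset fun x hx => Metric.ball_subset_ball' ?_
    rw [dist_zero_right]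
    linarith [hs x hx]
  have I : (s.card : ENNReal) * ENNReal.ofReal ((ρ / 2) ^ Module.finrank ℝ E)
        * μ (Metric.ball 0 1) ≤
      ENNReal.ofReal ((3 / 2) ^ Module.finrank ℝ E) * μ (Metric.ball 0 1) :=
    calc
      _ = μ (⋃ c ∈ s, Metric.ball (c : E) (ρ / 2)) := by
        rw [measure_biUnion_finset D fun c _ => measurableSet_ball]
        simp only [μ.addHaar_ball_of_pos _ (half_pos hρ)]
        simp only [Finset.sum_const, nsmul_eq_mul, mul_assoc]
      _ ≤ μ (Metric.ball (0 : E) (3 / 2)) := measure_mono A_subset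
      _ = _ := μ.addHaar_ball_of_pos _ (by norm_num)
  have J := (ENNReal.mul_le_mul_iff_left
    (Metric.measure_ball_pos μ (0 : E) zero_lt_one).ne' measure_ball_lt_top.ne).1 I
  have K := ENNReal.toReal_le_of_le_ofReal (by positivity) J
  rw [ENNReal.toReal_mul, ENNReal.toReal_natCast, ENNReal.toReal_ofReal (by positivity)] at K
  rw [show 3 / ρ = (3 / 2) / (ρ / 2) by field_simp, div_pow, le_div_iff₀ (by positivity)]
  exact K

/-- The unit ball has a `ρ`-net of cardinality at most `(3 / ρ) ^ dim`. -/
lemma exists_net_unitBall (E : Type*) [NormedAddCommGroup E] [NormedSpace ℝ E]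
    [FiniteDimensional ℝ E] {ρ : ℝ} (hρ : 0 < ρ) (hρ1 : ρ ≤ 1) :
    ∃ F : Finset E, (F.card : ℝ) ≤ (3 / ρ) ^ Module.finrank ℝ E ∧ (∀ c ∈ F, ‖c‖ ≤ 1) ∧
      ∀ x : E, ‖x‖ ≤ 1 → ∃ c ∈ F, ‖x - c‖ ≤ ρ := by
  classical
  set P : Set ℕ := {N | ∃ s : Finset E, s.card = N ∧ (∀ c ∈ s, ‖c‖ ≤ 1) ∧
    ∀ c ∈ s, ∀ d ∈ s, c ≠ d → ρ ≤ ‖c - d‖} with hP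
  have hne : P.Nonempty := ⟨0, ∅, by simp⟩
  have hbdd : BddAbove P := by
    refine ⟨⌊(3 / ρ) ^ Module.finrank ℝ E⌋₊, ?_⟩
    rintro _ ⟨s, rfl, h1, h2⟩
    exact Nat.le_floor (card_le_of_separated_unitBall hρ hρ1 s h1 h2)
  obtain ⟨F, hF, h1, h2⟩ := Nat.sSup_mem hne hbdd
  refine ⟨F, card_le_of_separated_unitBall hρ hρ1 F h1 h2, h1, fun x hx => ?_⟩
  by_contra! hc
  have hxF : x ∉ F := fun hx' => by
    have := hc x hx'
    rw [sub_self, norm_zero] at this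
    linarith
  have : F.card + 1 ∈ P := by
    refine ⟨insert x F, Finset.card_insert_of_notMem hxF, ?_, ?_⟩
    · simp only [Finset.mem_insert, forall_eq_or_imp]
      exact ⟨hx, h1⟩
    · simp only [Finset.mem_insert]
      rintro c (rfl | hc') d (rfl | hd') hcd
      · exact absurd rfl hcd
      · exact (hc d hd').le
      · rw [norm_sub_rev]; exact (hc c hc').le
      · exact h2 c hc' d hd' hcd
  have := le_csSup hbdd this
  omega

lemma enorm2_eq_norm {n : ℕ} (x : Fin n → ℝ) : enorm2 x = ‖WithLp.toLp 2 x‖ := by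
  simp [enorm2, EuclideanSpace.norm_eq]

lemma enorm2_add_le {n : ℕ} (x y : Fin n → ℝ) : enorm2 (x + y) ≤ enorm2 x + enorm2 y := by
  simp only [enorm2_eq_norm, WithLp.toLp_add]
  exact norm_add_le _ _

lemma enorm2_sub_comm {n : ℕ} (x y : Fin n → ℝ) : enorm2 (x - y) = enorm2 (y - x) := by
  simp only [enorm2_eq_norm, WithLp.toLp_sub]
  exact norm_sub_rev _ _

lemma enorm2_smul {n : ℕ} (a : ℝ) (x : Fin n → ℝ) : enorm2 (a • x) = |a| * enorm2 x := by
  simp only [enorm2_eq_norm, WithLp.toLp_smul, norm_smul, Real.norm_eq_abs]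

lemma abs_ip_le {n : ℕ} (x y : Fin n → ℝ) : |ip x y| ≤ enorm2 x * enorm2 y := by
  have : ip x y = inner ℝ (WithLp.toLp 2 x) (WithLp.toLp 2 y) := by
    simp [ip, PiLp.inner_apply, mul_comm]
  rw [this, enorm2_eq_norm, enorm2_eq_norm]
  exact abs_real_inner_le_norm _ _

/-- A finite net for the cylinder consisting of points of the unit ball. -/
lemma exists_net_cylSet (n r : ℕ) {ε : ℝ} (hε : 0 < ε) (hε1 : ε ≤ 1) :
    ∃ F : Finset (Fin n → ℝ), (F.card : ℝ) ≤ (3 / ε) ^ r ∧ (∀ c ∈ F, enorm2 c ≤ 1) ∧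
      ∀ x ∈ cylSet n r ε, ∃ c ∈ F, enorm2 (x - c) ≤ 2 * ε := by
  classical
  let ι := {i : Fin n // (i : ℕ) < r}
  obtain ⟨F, hF1, hF2, hF3⟩ := exists_net_unitBall (EuclideanSpace ℝ ι) hε hε1
  let ext : EuclideanSpace ℝ ι → Fin n → ℝ := fun u i => if h : (i : ℕ) < r then u ⟨i, h⟩ else 0
  have hsplit : ∀ x : Fin n → ℝ, ∑ i, (x i) ^ 2 = (∑ i : ι, (x i) ^ 2) +
      ∑ i ∈ Finset.univ.filter (fun i : Fin n => r ≤ (i : ℕ)), (x i) ^ 2 := by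
    intro x
    rw [← Finset.sum_filter_add_sum_filter_not Finset.univ (fun i : Fin n => (i : ℕ) < r)]
    simp only [not_lt]
    congr 1
    exact Finset.sum_subtype _ (by simp) _
  have hext : ∀ u (i : ι), ext u i = u i := fun u i => by simp [ext, i.2]
  have hext0 : ∀ u (i : Fin n), r ≤ (i : ℕ) → ext u i = 0 := fun u i hi => by
    simp [ext, not_lt.2 hi]
  refine ⟨F.image ext, ?_, ?_, ?_⟩
  · have hcard : Module.finrank ℝ (EuclideanSpace ℝ ι) ≤ r := by
      rw [finrank_euclideanSpace]
      have : Function.Injective (fun i : ι => (⟨i.1.1, i.2⟩ : Fin r)) := by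
        intro a b hab
        simp only [Fin.mk.injEq] at hab
        exact Subtype.ext (Fin.ext hab)
      simpa using Fintype.card_le_of_injective _ this
    calc ((F.image ext).card : ℝ) ≤ F.card := by exact_mod_cast Finset.card_image_le
      _ ≤ _ := hF1
      _ ≤ _ := pow_le_pow_right₀ (by rw [le_div_iff₀ hε]; linarith) hcard
  · simp only [Finset.mem_image, forall_exists_index, and_imp, forall_apply_eq_imp_iff₂]
    intro u hu
    have h0 : ∑ i ∈ Finset.univ.filter (fun i : Fin n => r ≤ (i : ℕ)), (ext u i) ^ 2 = 0 :=
      Finset.sum_eq_zero fun i hi => by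
        rw [hext0 u i (Finset.mem_filter.1 hi).2]; simp
    have := hF2 u hu
    rw [EuclideanSpace.norm_eq] at this
    unfold enorm2
    rw [hsplit, h0, add_zero]
    simpa [hext] using this
  · rintro x ⟨hx1, hx2⟩
    obtain ⟨c, hc, hxc⟩ := hF3 (WithLp.toLp 2 fun i : ι => x i) (by
      rw [EuclideanSpace.norm_eq]
      rw [Finset.sum_subtype (p := fun i : Fin n => (i : ℕ) < r) _ (by simp)] at hx1
      simpa using hx1)
    refine ⟨ext c, Finset.mem_image_of_mem _ hc, ?_⟩
    unfold enorm2
    rw [hsplit]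
    rw [Real.sqrt_le_left (by positivity)]
    have h1 : ∑ i : ι, ((x - ext c) i) ^ 2 ≤ ε ^ 2 := by
      rw [EuclideanSpace.norm_eq, Real.sqrt_le_left hε.le] at hxc
      simpa [hext] using hxc
    have h2 : ∑ i ∈ Finset.univ.filter (fun i : Fin n => r ≤ (i : ℕ)), ((x - ext c) i) ^ 2
        ≤ ε ^ 2 := by
      rw [Real.sqrt_le_left hε.le] at hx2
      refine le_of_eq_of_le (Finset.sum_congr rfl fun i hi => ?_) hx2
      rw [Pi.sub_apply, hext0 c i (Finset.mem_filter.1 hi).2, sub_zero]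
    nlinarith

/-- Hoeffding's inequality for the number of coordinates in a measurable set. -/
lemma hoeffding_count {X : Type*} [MeasurableSpace X] (ν : Measure X) [IsProbabilityMeasure ν]
    (m : ℕ) (hm : 0 < m) {S : Set X} [DecidablePred (· ∈ S)] (hS : MeasurableSet S)
    {t : ℝ} (ht : 0 ≤ t) :
    (Measure.pi fun _ : Fin m => ν) {ω | m * (ν.real S + t) ≤
      ((Finset.univ.filter fun i => ω i ∈ S).card : ℝ)} ≤
      ENNReal.ofReal (Real.exp (-2 * m * t ^ 2)) := by
  set f : X → ℝ := S.indicator (fun _ => 1) with hf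
  have hfm : Measurable f := measurable_const.indicator hS
  have hint : ∫ x, f x ∂ν = ν.real S := by simp [hf, integral_indicator hS]
  set P := Measure.pi fun _ : Fin m => ν
  have hsub : ∀ i ∈ (Finset.univ : Finset (Fin m)), HasSubgaussianMGF
      (fun ω : Fin m → X => f (ω i) - ν.real S) ((‖(1 : ℝ) - 0‖₊ / 2) ^ 2) P := by
    intro i _
    have h := hasSubgaussianMGF_of_mem_Icc (μ := P) (X := fun ω => f (ω i)) (a := 0) (b := 1)
      (hfm.comp (measurable_pi_apply i)).aemeasurable (Filter.Eventually.of_forall fun ω => by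
        by_cases h : ω i ∈ S <;> simp [hf, h])
    have he : ∫ ω, f (ω i) ∂P = ν.real S := by
      rw [← hint, ← (measurePreserving_eval (fun _ : Fin m => ν) i).map_eq,
        integral_map (measurable_pi_apply i).aemeasurable hfm.aestronglyMeasurable]
    rwa [he] at h
  have hind : iIndepFun (fun i (ω : Fin m → X) => f (ω i) - ν.real S) P :=
    iIndepFun_pi (X := fun _ x => f x - ν.real S) fun i => (hfm.sub_const _).aemeasurable
  have h := HasSubgaussianMGF.measure_sum_ge_le_of_iIndepFun hind hsub
    (ε := m * t) (by positivity)
  rw [← ofReal_measureReal]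
  refine ENNReal.ofReal_le_ofReal ?_
  have hset : {ω : Fin m → X | m * (ν.real S + t) ≤
      ((Finset.univ.filter fun i => ω i ∈ S).card : ℝ)} =
      {ω | m * t ≤ ∑ i, (f (ω i) - ν.real S)} := by
    ext ω
    have : ∑ i, f (ω i) = ((Finset.univ.filter fun i => ω i ∈ S).card : ℝ) := by
      rw [Finset.card_filter]
      push_cast
      exact Finset.sum_congr rfl fun i _ => by simp [hf, Set.indicator_apply]
    simp only [Set.mem_ofPred_eq, Finset.sum_sub_distrib, this]
    simp
    constructor <;> intro h <;> linarith
  rw [hset]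
  refine h.trans (le_of_eq ?_)
  congr 1
  have : (m : ℝ) ≠ 0 := by positivity
  simp
  field_simp

/-- Two-sided Hoeffding inequality for counts. -/
lemma hoeffding_count_abs {X : Type*} [MeasurableSpace X] (ν : Measure X) [IsProbabilityMeasure ν]
    (m : ℕ) (hm : 0 < m) {S : Set X} [DecidablePred (· ∈ S)] (hS : MeasurableSet S)
    {t : ℝ} (ht : 0 ≤ t) :
    (Measure.pi fun _ : Fin m => ν) {ω | m * t ≤
      |((Finset.univ.filter fun i => ω i ∈ S).card : ℝ) - m * ν.real S|} ≤
      2 * ENNReal.ofReal (Real.exp (-2 * m * t ^ 2)) := by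
  classical
  have h1 := hoeffding_count ν m hm hS ht
  have h2 := hoeffding_count ν m hm hS.compl ht
  rw [two_mul]
  refine le_trans (measure_mono ?_) ((measure_union_le _ _).trans (add_le_add h1 h2))
  intro ω hω
  simp only [Set.mem_ofPred_eq, Set.mem_union] at hω ⊢
  have hc : ((Finset.univ.filter fun i => ω i ∈ S).card : ℝ) +
      ((Finset.univ.filter fun i => ω i ∈ Sᶜ).card : ℝ) = m := by
    have := Finset.card_filter_add_card_filter_not (s := Finset.univ) (fun i => ω i ∈ S)
    simp only [Finset.card_univ, Fintype.card_fin] at this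
    exact_mod_cast this
  rw [probReal_compl_eq_one_sub hS]
  rcases le_abs.1 hω with h | h
  · left; linarith
  · right; linarith

/-- Uniform distribution on `[-lam, lam]`. -/
def unifIcc (lam : ℝ) : Measure ℝ :=
  (ENNReal.ofReal (2 * lam))⁻¹ • volume.restrict (Set.Icc (-lam) lam)

lemma unifIcc_apply (lam : ℝ) {s : Set ℝ} (hs : MeasurableSet s) :
    unifIcc lam s = (ENNReal.ofReal (2 * lam))⁻¹ * volume (s ∩ Set.Icc (-lam) lam) := by
  rw [unifIcc, Measure.smul_apply, Measure.restrict_apply hs, smul_eq_mul]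

lemma isProbabilityMeasure_unifIcc {lam : ℝ} (hl : 0 < lam) :
    IsProbabilityMeasure (unifIcc lam) := by
  constructor
  rw [unifIcc_apply _ MeasurableSet.univ, Set.univ_inter, Real.volume_Icc,
    show lam - -lam = 2 * lam by ring]
  exact ENNReal.inv_mul_cancel (by simpa using hl) ENNReal.ofReal_ne_top

lemma unifCube_eq_pi (m : ℕ) {lam : ℝ} (hl : 0 < lam) :
    unifCube m lam = Measure.pi fun _ : Fin m => unifIcc lam := by
  have := isProbabilityMeasure_unifIcc hl
  symm
  refine Measure.pi_eq fun s hs => ?_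
  rw [unifCube, Measure.smul_apply, Measure.restrict_apply (MeasurableSet.univ_pi hs),
    ← Set.pi_inter_distrib, volume_pi, Measure.pi_pi]
  simp_rw [unifIcc_apply lam (hs _)]
  rw [Finset.prod_mul_distrib, Finset.prod_const, Finset.card_univ, Fintype.card_fin,
    ENNReal.ofReal_pow (by positivity), ENNReal.inv_pow, smul_eq_mul]

/-- Law of a single row of the matrix together with its dither. -/
def rowLaw (n : ℕ) (lam : ℝ) : Measure ((Fin n → ℝ) × ℝ) := (gaussianPi n).prod (unifIcc lam)

lemma isProbabilityMeasure_rowLaw (n : ℕ) {lam : ℝ} (hl : 0 < lam) :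
    IsProbabilityMeasure (rowLaw n lam) := by
  have := isProbabilityMeasure_unifIcc hl
  unfold rowLaw; infer_instance

/-- The joint law of matrix and dithers, row by row. -/
lemma prod_law_apply (m n : ℕ) {lam : ℝ} (hl : 0 < lam)
    (S : Set ((Fin m → Fin n → ℝ) × (Fin m → ℝ))) :
    ((gaussianMatrix m n).prod (unifCube m lam)) S =
      (Measure.pi fun _ : Fin m => rowLaw n lam)
        {ω | ((fun i => (ω i).1), (fun i => (ω i).2)) ∈ S} := by
  have := isProbabilityMeasure_unifIcc hl
  rw [unifCube_eq_pi m hl]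
  unfold gaussianMatrix rowLaw
  exact ((measurePreserving_arrowProdEquivProdArrow (Fin n → ℝ) ℝ (Fin m)
    (fun _ => gaussianPi n) (fun _ => unifIcc lam)).measure_preimage_equiv S).symm

/-- Truncation to `[-lam, lam]`. -/
def clip (lam a : ℝ) : ℝ := max (-lam) (min a lam)

lemma abs_sub_clip_le (lam a : ℝ) (hl : 0 < lam) : |a - clip lam a| ≤ max (|a| - lam) 0 := by
  unfold clip
  rcases max_cases (-lam) (min a lam) with ⟨h1, h2⟩ | ⟨h1, h2⟩ <;>
  rcases min_cases a lam with ⟨h3, h4⟩ | ⟨h3, h4⟩ <;>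
  rcases abs_cases (a - max (-lam) (min a lam)) with ⟨h5, h6⟩ | ⟨h5, h6⟩ <;>
  rcases abs_cases a with ⟨h7, h8⟩ | ⟨h7, h8⟩ <;>
  rcases max_cases (|a| - lam) 0 with ⟨h9, h10⟩ | ⟨h9, h10⟩ <;> linarith

lemma signPM_ne_iff (u v : ℝ) : signPM u ≠ signPM v ↔ (u < 0 ∧ 0 ≤ v) ∨ (v < 0 ∧ 0 ≤ u) := by
  unfold signPM
  split_ifs with h1 h2 h2
  · simp; constructor <;> intros <;> linarith
  · exact iff_of_true (by norm_num) (Or.inr ⟨by linarith, h1⟩)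
  · exact iff_of_true (by norm_num) (Or.inl ⟨by linarith, h2⟩)
  · simp; constructor <;> intros <;> linarith

lemma unifIcc_Ico {lam : ℝ} (hl : 0 < lam) {a b : ℝ} (hab : a ≤ b) :
    unifIcc lam (Set.Ico (-b) (-a)) =
      ENNReal.ofReal ((2 * lam)⁻¹ * (clip lam b - clip lam a)) := by
  rw [unifIcc_apply _ measurableSet_Ico, ENNReal.ofReal_mul (p := (2 * lam)⁻¹) (by positivity),
    ENNReal.ofReal_inv_of_pos (by positivity)]
  congr 1
  have : (Set.Ico (-b) (-a) ∩ Set.Icc (-lam) lam : Set ℝ) =ᵐ[volume]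
      (Set.Ico (-b) (-a) ∩ Set.Ico (-lam) lam : Set ℝ) :=
    (Filter.EventuallyEq.refl _ _).inter Ico_ae_eq_Icc.symm
  rw [measure_congr this, Set.Ico_inter_Ico, Real.volume_Ico]
  have h1 : min (-a) lam = - max a (-lam) := by rw [← neg_neg lam, min_neg_neg]; simp
  have h2 : max (-b) (-lam) = - min b lam := max_neg_neg _ _
  unfold clip
  change ENNReal.ofReal (min (-a) lam - max (-b) (-lam)) = _
  rw [h1, h2]
  rcases le_total b (-lam) with hb | hb
  · have : min b lam = b := min_eq_left (by linarith)
    have h4 : min a lam = a := min_eq_left (by linarith)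
    rw [this, h4, max_eq_right (a := a) (by linarith), max_eq_left (b := b) (by linarith),
      max_eq_left (b := a) (by linarith)]
    rw [ENNReal.ofReal_of_nonpos (by linarith), sub_self, ENNReal.ofReal_zero]
  · rcases le_total a lam with ha | ha
    · rw [min_eq_left ha, max_eq_right (b := min b lam) (le_min hb (by linarith)), max_comm]
      congr 1; ring
    · rw [min_eq_right (a := a) ha, min_eq_right (a := b) (by linarith),
        max_eq_left (a := a) (by linarith)]
      rw [ENNReal.ofReal_of_nonpos (by linarith), sub_self, ENNReal.ofReal_zero]

lemma unifIcc_sign_ne {lam : ℝ} (hl : 0 < lam) (a b : ℝ) :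
    unifIcc lam {s | signPM (a + s) ≠ signPM (b + s)} =
      ENNReal.ofReal ((2 * lam)⁻¹ * |clip lam a - clip lam b|) := by
  wlog hab : a ≤ b generalizing a b
  · have := this b a (le_of_not_ge hab)
    rw [abs_sub_comm, ← this]
    simp only [ne_comm]
  have hmono : clip lam a ≤ clip lam b := by unfold clip; gcongr
  rw [abs_sub_comm, abs_of_nonneg (by linarith), ← unifIcc_Ico hl hab]
  congr 1
  ext s
  simp only [Set.mem_ofPred_eq, signPM_ne_iff, Set.mem_Ico]
  constructor
  · rintro (⟨h1, h2⟩ | ⟨h1, h2⟩) <;> constructor <;> linarith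
  · rintro ⟨h1, h2⟩; left; constructor <;> linarith

lemma unifIcc_abs_le {lam θ : ℝ} (hl : 0 < lam) (a : ℝ) :
    unifIcc lam {s | |a + s| ≤ θ} ≤ ENNReal.ofReal (θ / lam) := by
  have : {s : ℝ | |a + s| ≤ θ} = Set.Icc (-a - θ) (-a + θ) := by
    ext s
    simp only [Set.mem_ofPred_eq, abs_le, Set.mem_Icc]
    constructor <;> rintro ⟨h1, h2⟩ <;> constructor <;> linarith
  rw [this, unifIcc_apply _ measurableSet_Icc]
  calc _ ≤ (ENNReal.ofReal (2 * lam))⁻¹ * volume (Set.Icc (-a - θ) (-a + θ)) := by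
        gcongr; exact Set.inter_subset_left
    _ = _ := by
        rw [Real.volume_Icc, ← ENNReal.ofReal_inv_of_pos (by positivity),
          ← ENNReal.ofReal_mul (by positivity)]
        congr 1
        field_simp
        ring

lemma unifIcc_real_abs_le {lam θ : ℝ} (hl : 0 < lam) (hθ : 0 ≤ θ) (hθl : θ ≤ lam) :
    (unifIcc lam).real {s | |s| ≤ θ} = θ / lam := by
  have : {s : ℝ | |s| ≤ θ} = Set.Icc (-θ) θ := by ext s; simp [abs_le]
  rw [measureReal_def, this, unifIcc_apply _ measurableSet_Icc,
    Set.inter_eq_left.2 (Set.Icc_subset_Icc (by linarith) hθl), Real.volume_Icc,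
    ENNReal.toReal_mul, ENNReal.toReal_inv, ENNReal.toReal_ofReal (by linarith),
    ENNReal.toReal_ofReal (by linarith)]
  field_simp
  ring

/-- The set of rows on which the sign patterns of `x` and `y` differ. -/
def signDiff {n : ℕ} (x y : Fin n → ℝ) : Set ((Fin n → ℝ) × ℝ) :=
  {q | signPM (ip q.1 x + q.2) ≠ signPM (ip q.1 y + q.2)}

lemma measurable_signPM : Measurable signPM :=
  Measurable.ite measurableSet_Ici measurable_const measurable_const

lemma measurableSet_signDiff {n : ℕ} (x y : Fin n → ℝ) : MeasurableSet (signDiff x y) := by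
  have h : ∀ z : Fin n → ℝ, Measurable fun q : (Fin n → ℝ) × ℝ => signPM (ip q.1 z + q.2) :=
    fun z => measurable_signPM.comp (((measurable_ip z).comp measurable_fst).add measurable_snd)
  exact (measurableSet_eq_fun (h x) (h y)).compl

lemma rowLaw_real_signDiff {n : ℕ} {lam : ℝ} (hl : 0 < lam) {x y : Fin n → ℝ}
    (hx : enorm2 x ≤ 1) (hy : enorm2 y ≤ 1) :
    |2 * lam * (rowLaw n lam).real (signDiff x y) - √(2 / π) * enorm2 (x - y)| ≤
      4 * Real.exp (-lam ^ 2 / 2) / lam := by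
  have := isProbabilityMeasure_unifIcc hl
  have hclip : Measurable (clip lam) := by unfold clip; fun_prop
  have hmx := measurable_ip x
  have hmy := measurable_ip y
  set h : (Fin n → ℝ) → ℝ := fun g => |clip lam (ip g x) - clip lam (ip g y)| with hh
  have hhm : Measurable h := by fun_prop
  have hcb : ∀ a, |clip lam a| ≤ lam := fun a => abs_le.2
    ⟨le_max_left _ _, max_le (by linarith) (min_le_right _ _)⟩
  have hhi : Integrable h (gaussianPi n) := by
    refine Integrable.of_bound hhm.aestronglyMeasurable (2 * lam)
      (Filter.Eventually.of_forall fun g => ?_)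
    rw [Real.norm_eq_abs, hh, abs_abs]
    exact (abs_sub _ _).trans (by linarith [hcb (ip g x), hcb (ip g y)])
  have h1 : 2 * lam * (rowLaw n lam).real (signDiff x y) = ∫ g, h g ∂(gaussianPi n) := by
    rw [measureReal_def, rowLaw, Measure.prod_apply (measurableSet_signDiff x y)]
    have : ∀ g : Fin n → ℝ, unifIcc lam (Prod.mk g ⁻¹' signDiff x y)
        = ENNReal.ofReal ((2 * lam)⁻¹ * h g) := fun g =>
      unifIcc_sign_ne hl (ip g x) (ip g y)
    simp_rw [this]
    rw [← ofReal_integral_eq_lintegral_ofReal (hhi.const_mul _)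
      (Filter.Eventually.of_forall fun g => by simp only [hh, Pi.zero_apply]; positivity),
      integral_const_mul, ENNReal.toReal_ofReal]
    · field_simp
    · exact mul_nonneg (by positivity) (integral_nonneg fun g => abs_nonneg _)
  have hipsub : ∀ g, ip g (x - y) = ip g x - ip g y := fun g => by
    simp [ip, mul_sub, Finset.sum_sub_distrib]
  have habsI : Integrable (fun g => |ip g (x - y)|) (gaussianPi n) := by
    refine integrable_gaussianPi_comp_ip (x - y) (φ := fun y => |y|) measurable_norm ?_
    have := (integrable_pow_gaussianReal 1).abs.const_mul (enorm2 (x - y))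
    refine this.congr (Filter.Eventually.of_forall fun z => ?_)
    simp [abs_mul, abs_of_nonneg (enorm2_nonneg (x - y))]
  have h2 : √(2 / π) * enorm2 (x - y) = ∫ g, |ip g (x - y)| ∂(gaussianPi n) := by
    rw [integral_gaussianPi_comp_ip (x - y) (φ := fun y => |y|) measurable_norm]
    simp_rw [abs_mul, abs_of_nonneg (enorm2_nonneg (x - y))]
    rw [integral_const_mul, integral_abs_gaussianReal, mul_comm]
  have hmaxm : Measurable fun t : ℝ => max (|t| - lam) 0 := by fun_prop
  have hex : ∀ z : Fin n → ℝ, enorm2 z ≤ 1 →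
      Integrable (fun g => max (|ip g z| - lam) 0) (gaussianPi n) ∧
      ∫ g, max (|ip g z| - lam) 0 ∂(gaussianPi n) ≤ 2 * Real.exp (-lam ^ 2 / 2) / lam := by
    intro z hz
    obtain ⟨e1, e2⟩ := integral_gaussian_excess_le (enorm2_nonneg z) hz hl
    refine ⟨integrable_gaussianPi_comp_ip z hmaxm e1, ?_⟩
    rw [integral_gaussianPi_comp_ip z hmaxm]
    exact e2
  rw [h1, h2, ← integral_sub hhi habsI]
  calc _ ≤ ∫ g, |h g - (|ip g (x - y)|)| ∂(gaussianPi n) := abs_integral_le_integral_abs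
    _ ≤ ∫ g, (max (|ip g x| - lam) 0 + max (|ip g y| - lam) 0) ∂(gaussianPi n) := by
        refine integral_mono (hhi.sub habsI).abs ((hex x hx).1.add (hex y hy).1) fun g => ?_
        have e1 := abs_sub_clip_le lam (ip g x) hl
        have e2 := abs_sub_clip_le lam (ip g y) hl
        simp only [hh, hipsub]
        calc _ ≤ |(clip lam (ip g x) - clip lam (ip g y)) - (ip g x - ip g y)| :=
              abs_abs_sub_abs_le_abs_sub _ _
          _ = |(ip g y - clip lam (ip g y)) - (ip g x - clip lam (ip g x))| := by ring_nf
          _ ≤ _ := (abs_sub _ _).trans (by linarith)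
    _ ≤ _ := by
        rw [integral_add (hex x hx).1 (hex y hy).1]
        have := (hex x hx).2
        have := (hex y hy).2
        have e : 4 * Real.exp (-lam ^ 2 / 2) / lam = 2 * Real.exp (-lam ^ 2 / 2) / lam
          + 2 * Real.exp (-lam ^ 2 / 2) / lam := by ring
        linarith

/-- The set of rows for which the shifted projection of `x` is small. -/
def smallProj {n : ℕ} (x : Fin n → ℝ) (θ : ℝ) : Set ((Fin n → ℝ) × ℝ) :=
  {q | |ip q.1 x + q.2| ≤ θ}

lemma measurableSet_smallProj {n : ℕ} (x : Fin n → ℝ) (θ : ℝ) :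
    MeasurableSet (smallProj x θ) := by
  have : Measurable fun q : (Fin n → ℝ) × ℝ => |ip q.1 x + q.2| :=
    (((measurable_ip x).comp measurable_fst).add measurable_snd).abs
  exact measurableSet_le this measurable_const

lemma rowLaw_real_smallProj_le {n : ℕ} {lam θ : ℝ} (hl : 0 < lam) (x : Fin n → ℝ) (hθ : 0 ≤ θ) :
    (rowLaw n lam).real (smallProj x θ) ≤ θ / lam := by
  have := isProbabilityMeasure_unifIcc hl
  rw [measureReal_def]
  refine ENNReal.toReal_le_of_le_ofReal (by positivity) ?_
  rw [rowLaw, Measure.prod_apply (measurableSet_smallProj x θ)]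
  calc _ ≤ ∫⁻ _, ENNReal.ofReal (θ / lam) ∂(gaussianPi n) :=
        lintegral_mono fun g => unifIcc_abs_le hl (ip g x)
    _ = _ := by simp

/-- Euclidean norm of the restriction of a vector to a set of coordinates. -/
def normOn {n : ℕ} (s : Finset (Fin n)) (g : Fin n → ℝ) : ℝ := √(∑ i ∈ s, (g i) ^ 2)

lemma normOn_nonneg {n : ℕ} (s : Finset (Fin n)) (g : Fin n → ℝ) : 0 ≤ normOn s g :=
  Real.sqrt_nonneg _

lemma normOn_sq {n : ℕ} (s : Finset (Fin n)) (g : Fin n → ℝ) :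
    normOn s g ^ 2 = ∑ i ∈ s, (g i) ^ 2 :=
  Real.sq_sqrt (Finset.sum_nonneg fun _ _ => sq_nonneg _)

lemma continuous_normOn {n : ℕ} (s : Finset (Fin n)) : Continuous (normOn s) := by
  unfold normOn; fun_prop

lemma integrable_eval_sq {n : ℕ} (i : Fin n) :
    Integrable (fun g : Fin n → ℝ => (g i) ^ 2) (gaussianPi n) := by
  exact integrable_comp_eval (X := fun _ : Fin n => ℝ)
    (μ := fun _ => gaussianReal 0 1) (i := i) (f := fun y : ℝ => y ^ 2)
    (integrable_pow_gaussianReal 2)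

lemma integral_eval_sq {n : ℕ} (i : Fin n) :
    ∫ g : Fin n → ℝ, (g i) ^ 2 ∂(gaussianPi n) = 1 := by
  rw [← integral_sq_gaussianReal]
  exact integral_comp_eval (X := fun _ : Fin n => ℝ)
    (μ := fun _ => gaussianReal 0 1) (i := i) (f := fun y : ℝ => y ^ 2)
    (integrable_pow_gaussianReal 2).aestronglyMeasurable

lemma integrable_eval_abs {n : ℕ} (i : Fin n) :
    Integrable (fun g : Fin n → ℝ => |g i|) (gaussianPi n) := by
  refine integrable_comp_eval (X := fun _ : Fin n => ℝ)
    (μ := fun _ => gaussianReal 0 1) (i := i) (f := fun y : ℝ => |y|) ?_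
  simpa using (integrable_pow_gaussianReal 1).abs

lemma integral_eval_abs {n : ℕ} (i : Fin n) :
    ∫ g : Fin n → ℝ, |g i| ∂(gaussianPi n) = √(2 / π) := by
  rw [← integral_abs_gaussianReal]
  exact integral_comp_eval (X := fun _ : Fin n => ℝ)
    (μ := fun _ => gaussianReal 0 1) (i := i) (f := fun y : ℝ => |y|)
    measurable_norm.aestronglyMeasurable

lemma integrable_normOn_sq {n : ℕ} (s : Finset (Fin n)) :
    Integrable (fun g => normOn s g ^ 2) (gaussianPi n) := by
  simp_rw [normOn_sq]
  exact integrable_finsetSum _ fun i _ => integrable_eval_sq i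

lemma integral_normOn_sq {n : ℕ} (s : Finset (Fin n)) :
    ∫ g, normOn s g ^ 2 ∂(gaussianPi n) = s.card := by
  simp_rw [normOn_sq]
  rw [integral_finsetSum _ fun i _ => integrable_eval_sq i]
  simp [integral_eval_sq]

lemma integrable_normOn {n : ℕ} (s : Finset (Fin n)) :
    Integrable (normOn s) (gaussianPi n) := by
  refine Integrable.mono' ((integrable_normOn_sq s).add (integrable_const 1))
    (continuous_normOn s).aestronglyMeasurable (Filter.Eventually.of_forall fun g => ?_)
  rw [Real.norm_eq_abs, abs_of_nonneg (normOn_nonneg s g)]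
  simp only [Pi.add_apply]
  nlinarith [sq_nonneg (normOn s g - 1), normOn_nonneg s g]

lemma integral_normOn_le {n : ℕ} (s : Finset (Fin n)) {N : ℝ} (hN : 0 < N) (hs : s.card ≤ N) :
    ∫ g, normOn s g ∂(gaussianPi n) ≤ √N := by
  have hp : 0 < √N := Real.sqrt_pos.2 hN
  calc _ ≤ ∫ g, (normOn s g ^ 2 * (2 * √N)⁻¹ + √N / 2) ∂(gaussianPi n) := by
        refine integral_mono (integrable_normOn s)
          (((integrable_normOn_sq s).mul_const _).add (integrable_const _)) fun g => ?_
        have : normOn s g ^ 2 * (2 * √N)⁻¹ + √N / 2 - normOn s g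
            = (normOn s g - √N) ^ 2 / (2 * √N) := by field_simp; ring
        have h2 : 0 ≤ (normOn s g - √N) ^ 2 / (2 * √N) := by positivity
        linarith
    _ = s.card * (2 * √N)⁻¹ + √N / 2 := by
        rw [integral_add ((integrable_normOn_sq s).mul_const _) (integrable_const _),
          integral_mul_const, integral_normOn_sq]
        simp
    _ ≤ N * (2 * √N)⁻¹ + √N / 2 := by gcongr
    _ = √N := by
        nth_rewrite 1 [← Real.sq_sqrt hN.le]
        field_simp; ring

lemma le_integral_normOn {n : ℕ} (s : Finset (Fin n)) :
    √(2 / π) * √s.card ≤ ∫ g, normOn s g ∂(gaussianPi n) := by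
  rcases s.eq_empty_or_nonempty with rfl | hne
  · simp [normOn]
  have hp : 0 < √(s.card : ℝ) := Real.sqrt_pos.2 (by exact_mod_cast hne.card_pos)
  calc √(2 / π) * √s.card = ∫ g : Fin n → ℝ, (∑ i ∈ s, |g i|) / √s.card ∂(gaussianPi n) := by
        rw [integral_div, integral_finsetSum _ fun i _ => integrable_eval_abs i]
        simp only [integral_eval_abs, Finset.sum_const, nsmul_eq_mul]
        rw [eq_div_iff hp.ne', mul_assoc, Real.mul_self_sqrt (by positivity), mul_comm]
    _ ≤ _ := by
        refine integral_mono ((integrable_finsetSum _ fun i _ => integrable_eval_abs i).div_const _)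
          (integrable_normOn s) fun g => ?_
        simp only
        rw [div_le_iff₀ hp]
        refine abs_le_of_sq_le_sq' ?_ (mul_nonneg (normOn_nonneg _ _) hp.le) |>.2
        rw [mul_pow, normOn_sq, Real.sq_sqrt (by positivity)]
        have := sq_sum_le_card_mul_sum_sq (s := s) (f := fun i => |g i|)
        simp only [sq_abs] at this
        linarith

/-- The first `r` coordinates. -/
def lowIdx (n r : ℕ) : Finset (Fin n) := Finset.univ.filter fun i => (i : ℕ) < r

/-- The coordinates after the first `r`. -/
def highIdx (n r : ℕ) : Finset (Fin n) := Finset.univ.filter fun i => r ≤ (i : ℕ)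

lemma mem_cylSet {n r : ℕ} {ε : ℝ} {x : Fin n → ℝ} :
    x ∈ cylSet n r ε ↔ normOn (lowIdx n r) x ≤ 1 ∧ normOn (highIdx n r) x ≤ ε := Iff.rfl

lemma sum_low_add_sum_high (n r : ℕ) (f : Fin n → ℝ) :
    ∑ i ∈ lowIdx n r, f i + ∑ i ∈ highIdx n r, f i = ∑ i, f i := by
  unfold lowIdx highIdx
  rw [← Finset.sum_filter_add_sum_filter_not Finset.univ (fun i : Fin n => (i : ℕ) < r)]
  simp only [not_lt]

lemma card_lowIdx {n r : ℕ} (h : r ≤ n) : (lowIdx n r).card = r := by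
  unfold lowIdx
  rw [Fin.card_filter_val_lt]
  exact min_eq_right h

lemma card_highIdx (n r : ℕ) : (highIdx n r).card + (lowIdx n r).card = n := by
  unfold lowIdx highIdx
  have := Finset.card_filter_add_card_filter_not (s := (Finset.univ : Finset (Fin n)))
    (fun i => (i : ℕ) < r)
  simp only [not_lt, Finset.card_univ, Fintype.card_fin] at this
  omega

lemma isGreatest_cylSet (n r : ℕ) {ε : ℝ} (hε : 0 ≤ ε) (g : Fin n → ℝ) :
    IsGreatest ((fun t => |ip g t|) '' cylSet n r ε)
      (normOn (lowIdx n r) g + ε * normOn (highIdx n r) g) := by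
  constructor
  · set a := normOn (lowIdx n r) g with ha
    set b := normOn (highIdx n r) g with hb
    have ha0 : 0 ≤ a := normOn_nonneg _ _
    have hb0 : 0 ≤ b := normOn_nonneg _ _
    have hl : ∀ i ∈ lowIdx n r, (i : ℕ) < r := fun i hi => by simpa [lowIdx] using hi
    have hh : ∀ i ∈ highIdx n r, ¬ (i : ℕ) < r := fun i hi => by simpa [highIdx] using hi
    have key : ∀ u : ℝ, u * u⁻¹ * u = u := fun u => by
      rcases eq_or_ne u 0 with rfl | h
      · simp
      · field_simp
    have kle : ∀ u : ℝ, 0 ≤ u → u⁻¹ * u ≤ 1 := fun u _ => by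
      rcases eq_or_ne u 0 with rfl | h
      · simp
      · rw [inv_mul_cancel₀ h]
    refine ⟨fun i => if (i : ℕ) < r then a⁻¹ * g i else ε * b⁻¹ * g i, mem_cylSet.2 ⟨?_, ?_⟩, ?_⟩
    · have : normOn (lowIdx n r)
          (fun i => if (i : ℕ) < r then a⁻¹ * g i else ε * b⁻¹ * g i) = a⁻¹ * a := by
        unfold normOn
        rw [Finset.sum_congr rfl (g := fun i => (a⁻¹) ^ 2 * (g i) ^ 2)
          (fun i hi => by simp only [if_pos (hl i hi), mul_pow]), ← Finset.mul_sum, ← normOn_sq,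
          ← ha,
          ← mul_pow, Real.sqrt_sq (by positivity)]
      rw [this]
      exact kle a ha0
    · have : normOn (highIdx n r)
          (fun i => if (i : ℕ) < r then a⁻¹ * g i else ε * b⁻¹ * g i) = ε * (b⁻¹ * b) := by
        unfold normOn
        rw [Finset.sum_congr rfl (g := fun i => (ε * b⁻¹) ^ 2 * (g i) ^ 2)
          (fun i hi => by simp only [if_neg (hh i hi), mul_pow]), ← Finset.mul_sum, ← normOn_sq,
          ← hb,
          ← mul_pow, Real.sqrt_sq (by positivity), mul_assoc]
      rw [this]
      exact mul_le_of_le_one_right hε (kle b hb0)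
    · simp only [ip]
      rw [← sum_low_add_sum_high n r,
        Finset.sum_congr rfl (s₁ := lowIdx n r) (g := fun i => a⁻¹ * (g i) ^ 2)
          (fun i hi => by rw [if_pos (hl i hi)]; ring),
        Finset.sum_congr rfl (s₁ := highIdx n r) (g := fun i => ε * b⁻¹ * (g i) ^ 2)
          (fun i hi => by rw [if_neg (hh i hi)]; ring),
        ← Finset.mul_sum, ← Finset.mul_sum, ← normOn_sq, ← normOn_sq, ← ha, ← hb,
        show a⁻¹ * a ^ 2 = a * a⁻¹ * a by ring, key,
        show ε * b⁻¹ * b ^ 2 = ε * (b * b⁻¹ * b) by ring, key, abs_of_nonneg (by positivity)]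
  · rintro _ ⟨t, ht, rfl⟩
    obtain ⟨h1, h2⟩ := mem_cylSet.1 ht
    have cs : ∀ s : Finset (Fin n), |∑ i ∈ s, g i * t i| ≤ normOn s g * normOn s t := fun s => by
      refine abs_le_of_sq_le_sq ?_ (mul_nonneg (normOn_nonneg _ _) (normOn_nonneg _ _))
      rw [mul_pow, normOn_sq, normOn_sq]
      exact Finset.sum_mul_sq_le_sq_mul_sq s g t
    simp only [ip]
    rw [← sum_low_add_sum_high n r]
    calc _ ≤ normOn (lowIdx n r) g * normOn (lowIdx n r) t
          + normOn (highIdx n r) g * normOn (highIdx n r) t :=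
          (abs_add_le _ _).trans (add_le_add (cs _) (cs _))
      _ ≤ normOn (lowIdx n r) g * 1 + normOn (highIdx n r) g * ε := by
          gcongr <;> exact normOn_nonneg _ _
      _ = _ := by ring

lemma meanWidth_cylSet (n r : ℕ) {ε : ℝ} (hε : 0 ≤ ε) :
    meanWidth (cylSet n r ε) = ∫ g, normOn (lowIdx n r) g ∂(gaussianPi n)
      + ε * ∫ g, normOn (highIdx n r) g ∂(gaussianPi n) := by
  unfold meanWidth
  simp_rw [(isGreatest_cylSet n r hε _).csSup_eq]
  rw [integral_add (integrable_normOn _) ((integrable_normOn _).const_mul _), integral_const_mul]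

lemma meanWidth_cylSet_sq_le {n r : ℕ} {ε : ℝ} (hr : 0 < r) (hrn : r ≤ n) (hε : 0 ≤ ε)
    (hn : ε ^ 2 * n ≤ r) : meanWidth (cylSet n r ε) ^ 2 ≤ 4 * r := by
  have hr' : (0 : ℝ) < r := by exact_mod_cast hr
  have hn' : (0 : ℝ) < n := by exact_mod_cast hr.trans_le hrn
  have h1 := integral_normOn_le (lowIdx n r) hr' (by rw [card_lowIdx hrn])
  have h2 := integral_normOn_le (highIdx n r) hn' (by
    exact_mod_cast (card_highIdx n r ▸ Nat.le_add_right _ _))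
  have h3 : ε * √n ≤ √r := by
    rw [← Real.sqrt_sq hε, ← Real.sqrt_mul (sq_nonneg _)]
    exact Real.sqrt_le_sqrt hn
  have h4 : meanWidth (cylSet n r ε) ≤ 2 * √r := by
    rw [meanWidth_cylSet n r hε]
    have := mul_le_mul_of_nonneg_left h2 hε
    linarith
  have h0 : 0 ≤ meanWidth (cylSet n r ε) := by
    rw [meanWidth_cylSet n r hε]
    exact add_nonneg (integral_nonneg fun g => normOn_nonneg _ _)
      (mul_nonneg hε (integral_nonneg fun g => normOn_nonneg _ _))
  calc _ ≤ (2 * √r) ^ 2 := by gcongr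
    _ = 4 * r := by rw [mul_pow, Real.sq_sqrt hr'.le]; norm_num

lemma le_meanWidth_cylSet_sq {n r : ℕ} {ε : ℝ} (hrn : r ≤ n) (hε : 0 ≤ ε) :
    r / 2 ≤ meanWidth (cylSet n r ε) ^ 2 := by
  have h1 := le_integral_normOn (lowIdx n r)
  rw [card_lowIdx hrn] at h1
  have h2 : √(2 / π) * √r ≤ meanWidth (cylSet n r ε) := by
    rw [meanWidth_cylSet n r hε]
    have := mul_nonneg hε (integral_nonneg (μ := gaussianPi n)
      fun g => normOn_nonneg (highIdx n r) g)
    linarith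
  calc (r / 2 : ℝ) ≤ 2 / π * r := by
        have : (1 / 2 : ℝ) ≤ 2 / π := by
          rw [div_le_div_iff₀ (by norm_num) Real.pi_pos]; linarith [Real.pi_le_four]
        nlinarith [(Nat.cast_nonneg r : (0 : ℝ) ≤ r)]
    _ = (√(2 / π) * √r) ^ 2 := by
        rw [mul_pow, Real.sq_sqrt (by positivity), Real.sq_sqrt (by positivity)]
    _ ≤ _ := by gcongr

/-- The combination of the rows of `A` with coefficients `a`. -/
def rowComb {m n : ℕ} (a : Fin m → ℝ) (A : Fin m → Fin n → ℝ) : Fin n → ℝ :=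
  fun j => ∑ i, A i j * a i

lemma rowComb_transpose {m n : ℕ} (a : Fin m → ℝ) (B : Fin n → Fin m → ℝ) (j : Fin n) :
    rowComb a (fun i j => B j i) j = ip (B j) a := rfl

lemma ip_rowComb {m n : ℕ} (a : Fin m → ℝ) (A : Fin m → Fin n → ℝ) (z : Fin n → ℝ) :
    ip (rowComb a A) z = ∑ i, a i * ip (A i) z := by
  unfold ip rowComb
  simp_rw [Finset.sum_mul, Finset.mul_sum]
  rw [Finset.sum_comm]
  exact Finset.sum_congr rfl fun i _ => Finset.sum_congr rfl fun j _ => by ring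

lemma gaussianMatrix_rowComb_le {m n : ℕ} (a : Fin m → ℝ) {k : ℝ} (hk : 0 < k)
    (ha : enorm2 a ^ 2 = k) (s : ℝ) :
    gaussianMatrix m n {A | s ≤ enorm2 (rowComb a A) ^ 2} ≤
      ENNReal.ofReal (√2 ^ n * Real.exp (-(s / (4 * k)))) := by
  set φ : ℝ → ℝ := fun y => Real.exp (y ^ 2 / (4 * k)) with hφ
  have hφm : Measurable φ := by fun_prop
  have hscale : (fun y => φ (enorm2 a * y)) = fun y => Real.exp (y ^ 2 / 4) := by
    funext y
    simp only [hφ, mul_pow, ha]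
    congr 1
    field_simp
  have hint : Integrable (fun g => φ (ip g a)) (gaussianPi m) :=
    integrable_gaussianPi_comp_ip a hφm (by rw [hscale]; exact integrable_exp_sq_div_four)
  have hval : ∫ g, φ (ip g a) ∂(gaussianPi m) = √2 := by
    rw [integral_gaussianPi_comp_ip a hφm]
    calc _ = ∫ y, (fun y => φ (enorm2 a * y)) y ∂(gaussianReal 0 1) := rfl
      _ = _ := by rw [hscale]; exact integral_exp_sq_div_four
  set F : (Fin n → Fin m → ℝ) → ℝ := fun B => ∏ j, φ (ip (B j) a) with hF
  have hFi : Integrable F (gaussianMatrix n m) :=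
    Integrable.fintype_prod (f := fun _ : Fin n => fun g => φ (ip g a)) fun _ => hint
  have hFv : ∫ B, F B ∂(gaussianMatrix n m) = √2 ^ n := by
    rw [hF, gaussianMatrix, integral_fintype_prod_eq_pow (fun g => φ (ip g a)), hval]
    simp
  have hmark := mul_meas_ge_le_integral_of_nonneg (μ := gaussianMatrix n m)
    (f := F) (Filter.Eventually.of_forall fun B => Finset.prod_nonneg fun j _ =>
      (Real.exp_pos _).le) hFi (Real.exp (s / (4 * k)))
  rw [hFv] at hmark
  have hset : (gaussianMatrix m n) {A | s ≤ enorm2 (rowComb a A) ^ 2} ≤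
      gaussianMatrix n m {B | Real.exp (s / (4 * k)) ≤ F B} := by
    have hmp := gaussianMatrix_map_transpose n m
    have hms : MeasurableSet {A : Fin m → Fin n → ℝ | s ≤ enorm2 (rowComb a A) ^ 2} := by
      unfold enorm2 rowComb
      exact measurableSet_le measurable_const (by fun_prop)
    rw [← hmp.measure_preimage hms.nullMeasurableSet]
    refine measure_mono fun B hB => ?_
    simp only [Set.mem_preimage, Set.mem_ofPred_eq, enorm2_sq, rowComb_transpose] at hB
    simp only [Set.mem_ofPred_eq, hF, hφ]
    rw [← Real.exp_sum, ← Finset.sum_div]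
    gcongr
  refine hset.trans ?_
  rw [Real.exp_neg, ← div_eq_mul_inv]
  rw [measureReal_def] at hmark
  rw [← ENNReal.ofReal_toReal (measure_ne_top (gaussianMatrix n m) _)]
  refine ENNReal.ofReal_le_ofReal ?_
  rw [le_div_iff₀ (Real.exp_pos _), mul_comm]
  exact hmark

/-- With high probability no short vector has many large projections. -/
lemma gaussianMatrix_exists_many_large_le {m n k : ℕ} (hk : 0 < k) {θ ρ : ℝ} (hθ : 0 ≤ θ)
    (hρ : 0 < ρ) :
    gaussianMatrix m n {A | ∃ z : Fin n → ℝ, enorm2 z ≤ ρ ∧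
        k ≤ (Finset.univ.filter fun i => θ ≤ |ip (A i) z|).card} ≤
      ENNReal.ofReal ((2 * Real.exp 1 * m / k) ^ k *
        (√2 ^ n * Real.exp (-(k * θ ^ 2 / (4 * ρ ^ 2))))) := by
  have hk' : (0 : ℝ) < k := by exact_mod_cast hk
  set sgn : Finset (Fin m) → Finset (Fin m) → Fin m → ℝ :=
    fun S T i => if i ∈ S then (if i ∈ T then 1 else -1) else 0 with hsgn
  set s : ℝ := (k * θ / ρ) ^ 2 with hs
  set b : ℝ := √2 ^ n * Real.exp (-(k * θ ^ 2 / (4 * ρ ^ 2))) with hb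
  have hb0 : 0 ≤ b := by positivity
  have hsub : {A : Fin m → Fin n → ℝ | ∃ z : Fin n → ℝ, enorm2 z ≤ ρ ∧
        k ≤ (Finset.univ.filter fun i => θ ≤ |ip (A i) z|).card} ⊆
      ⋃ S ∈ Finset.powersetCard k (Finset.univ : Finset (Fin m)), ⋃ T ∈ S.powerset,
        {A | s ≤ enorm2 (rowComb (sgn S T) A) ^ 2} := by
    rintro A ⟨z, hz, hcard⟩
    obtain ⟨S, hS, hSk⟩ := Finset.exists_subset_card_eq hcard
    simp only [Set.mem_iUnion]
    refine ⟨S, Finset.mem_powersetCard.2 ⟨Finset.subset_univ _, hSk⟩,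
      S.filter fun i => 0 ≤ ip (A i) z, Finset.mem_powerset.2 (Finset.filter_subset _ _), ?_⟩
    set T := S.filter fun i => 0 ≤ ip (A i) z with hT
    have h1 : k * θ ≤ ip (rowComb (sgn S T) A) z := by
      rw [ip_rowComb]
      calc (k * θ : ℝ) = ∑ i ∈ S, θ := by rw [Finset.sum_const, hSk, nsmul_eq_mul]
        _ ≤ ∑ i ∈ S, |ip (A i) z| := Finset.sum_le_sum fun i hi =>
            (Finset.mem_filter.1 (hS hi)).2
        _ = ∑ i ∈ S, sgn S T i * ip (A i) z := by
            refine Finset.sum_congr rfl fun i hi => ?_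
            by_cases h : 0 ≤ ip (A i) z
            · simp [hsgn, hT, hi, h, abs_of_nonneg h]
            · simp [hsgn, hT, hi, h, abs_of_neg (not_le.1 h)]
        _ = ∑ i, sgn S T i * ip (A i) z := by
            refine Finset.sum_subset (Finset.subset_univ _) fun i _ hi => ?_
            simp [hsgn, hi]
    have h2 : k * θ / ρ ≤ enorm2 (rowComb (sgn S T) A) := by
      rw [div_le_iff₀ hρ]
      calc _ ≤ _ := h1
        _ ≤ _ := (le_abs_self _).trans (abs_ip_le _ _)
        _ ≤ _ := mul_le_mul_of_nonneg_left hz (enorm2_nonneg _)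
    show s ≤ _
    rw [hs]
    gcongr
  have hone : ∀ S ∈ Finset.powersetCard k (Finset.univ : Finset (Fin m)), ∀ T ∈ S.powerset,
      gaussianMatrix m n {A | s ≤ enorm2 (rowComb (sgn S T) A) ^ 2} ≤ ENNReal.ofReal b := by
    intro S hS T hT
    have hn : enorm2 (sgn S T) ^ 2 = k := by
      rw [enorm2_sq, ← (Finset.mem_powersetCard.1 hS).2]
      have : ∀ i, sgn S T i ^ 2 = if i ∈ S then 1 else 0 := fun i => by
        simp only [hsgn]; split_ifs <;> norm_num
      simp [this]
    refine (gaussianMatrix_rowComb_le _ hk' hn s).trans (le_of_eq ?_)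
    rw [hb, hs]
    congr 4
    field_simp
  calc _ ≤ _ := measure_mono hsub
    _ ≤ ∑ S ∈ Finset.powersetCard k (Finset.univ : Finset (Fin m)), ∑ T ∈ S.powerset,
        ENNReal.ofReal b := by
        refine (measure_biUnion_finset_le _ _).trans (Finset.sum_le_sum fun S hS => ?_)
        exact (measure_biUnion_finset_le _ _).trans (Finset.sum_le_sum fun T hT => hone S hS T hT)
    _ = ∑ S ∈ Finset.powersetCard k (Finset.univ : Finset (Fin m)),
        ((2 ^ k : ℕ) : ENNReal) * ENNReal.ofReal b := by
        refine Finset.sum_congr rfl fun S hS => ?_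
        rw [Finset.sum_const, Finset.card_powerset, (Finset.mem_powersetCard.1 hS).2,
          nsmul_eq_mul]
    _ = ENNReal.ofReal ((m.choose k * 2 ^ k) * b) := by
        rw [Finset.sum_const, Finset.card_powersetCard, Finset.card_univ, Fintype.card_fin,
          nsmul_eq_mul, ENNReal.ofReal_mul (p := m.choose k * 2 ^ k) (by positivity),
          ENNReal.ofReal_mul (p := (m.choose k : ℝ)) (by positivity), mul_assoc,
          ENNReal.ofReal_natCast, ← ENNReal.ofReal_natCast (2 ^ k)]
        push_cast
        rfl
    _ ≤ _ := by
        refine ENNReal.ofReal_le_ofReal (mul_le_mul_of_nonneg_right ?_ hb0)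
        have h1 : (m.choose k : ℝ) ≤ m ^ k / k.factorial := Nat.choose_le_pow_div k m
        have h2 := Real.pow_div_factorial_le_exp (k : ℝ) hk'.le k
        calc (m.choose k * 2 ^ k : ℝ) ≤ m ^ k / k.factorial * 2 ^ k := by gcongr
          _ = (2 * m / k) ^ k * (k ^ k / k.factorial) := by
              rw [div_pow, mul_pow]; field_simp
          _ ≤ (2 * m / k) ^ k * Real.exp k := by gcongr
          _ = _ := by
              rw [← Real.exp_one_pow k, ← mul_pow]
              congr 1; ring

open Classical in
/-- Number of indices whose row lies in `S`. -/
def rowCount {m : ℕ} {X : Type*} (S : Set X) (ω : Fin m → X) : ℕ :=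
  (Finset.univ.filter fun i => ω i ∈ S).card

lemma rowCount_le_add {m : ℕ} {X : Type*} {S T U : Set X} (h : S ⊆ T ∪ U) (ω : Fin m → X) :
    rowCount S ω ≤ rowCount T ω + rowCount U ω := by
  classical
  unfold rowCount
  refine le_trans (Finset.card_le_card ?_) (Finset.card_union_le _ _)
  intro i hi
  have := h (Finset.mem_filter.1 hi).2
  simpa using this

lemma hamming_eq_rowCount {m n : ℕ} (ω : Fin m → (Fin n → ℝ) × ℝ) (x y : Fin n → ℝ) :
    hamming (signVec (mulVecR (fun i => (ω i).1) x + fun i => (ω i).2))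
      (signVec (mulVecR (fun i => (ω i).1) y + fun i => (ω i).2)) = rowCount (signDiff x y) ω := by
  classical
  unfold hamming rowCount
  refine congrArg _ (Finset.ext fun i => ?_)
  rw [Finset.mem_filter, Finset.mem_filter]
  rfl

/-- Rows with a large projection onto `z`. -/
def largeProj {n : ℕ} (z : Fin n → ℝ) (θ : ℝ) : Set ((Fin n → ℝ) × ℝ) :=
  {q | θ ≤ |ip q.1 z|}

lemma ip_sub {n : ℕ} (g x y : Fin n → ℝ) : ip g (x - y) = ip g x - ip g y := by
  simp [ip, mul_sub, Finset.sum_sub_distrib]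

lemma signDiff_comm {n : ℕ} (x y : Fin n → ℝ) : signDiff x y = signDiff y x := by
  ext q; exact ne_comm

lemma signDiff_subset_trans {n : ℕ} (x y z : Fin n → ℝ) :
    signDiff x z ⊆ signDiff x y ∪ signDiff y z := by
  intro q hq
  by_contra! h
  simp only [Set.mem_union, not_or] at h
  obtain ⟨h1, h2⟩ := h
  simp only [signDiff, Set.mem_ofPred_eq, not_not] at h1 h2 hq
  exact hq (h1.trans h2)

lemma signDiff_subset {n : ℕ} (x c : Fin n → ℝ) (θ : ℝ) :
    signDiff x c ⊆ smallProj c θ ∪ largeProj (x - c) θ := by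
  intro q hq
  by_contra! h
  simp only [Set.mem_union, not_or, smallProj, largeProj, Set.mem_ofPred_eq, not_le, ip_sub] at h
  obtain ⟨h1, h2⟩ := h
  rw [abs_lt] at h2
  rcases (signPM_ne_iff _ _).1 hq with ⟨h3, h4⟩ | ⟨h3, h4⟩
  · rw [abs_of_nonneg h4] at h1; linarith
  · rw [abs_of_neg h3] at h1; linarith

lemma sqrt_two_pi_le : √(2 * π) ≤ 3 := by
  rw [Real.sqrt_le_left (by norm_num)]
  nlinarith [Real.pi_le_four]

/-- Uniform estimate of normalized Hamming distances from estimates on a net. -/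
lemma abs_hamming_sub_le_of_net {m n r : ℕ} (hm : 0 < m) {lam ε θ t u v : ℝ} (hl : 0 < lam)
    {F : Finset (Fin n → ℝ)} (hF1 : ∀ c ∈ F, enorm2 c ≤ 1)
    (hF : ∀ x ∈ cylSet n r ε, ∃ c ∈ F, enorm2 (x - c) ≤ 2 * ε)
    {ω : Fin m → (Fin n → ℝ) × ℝ}
    (h1 : ∀ x ∈ F, ∀ y ∈ F,
      |(rowCount (signDiff x y) ω : ℝ) - m * (rowLaw n lam).real (signDiff x y)| ≤ m * t)
    (h2 : ∀ x ∈ F, (rowCount (smallProj x θ) ω : ℝ) ≤ m * u)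
    (h3 : ∀ z, enorm2 z ≤ 2 * ε → (rowCount (largeProj z θ) ω : ℝ) ≤ m * v)
    {x y : Fin n → ℝ} (hx : x ∈ cylSet n r ε) (hy : y ∈ cylSet n r ε) :
    |√(2 * π) * lam / m * (rowCount (signDiff x y) ω : ℝ) - enorm2 (x - y)| ≤
      3 * lam * (t + 2 * (u + v)) + 6 * Real.exp (-lam ^ 2 / 2) / lam + 4 * ε := by
  have hm' : (0 : ℝ) < m := by exact_mod_cast hm
  obtain ⟨c, hc, hxc⟩ := hF x hx
  obtain ⟨d, hd, hyd⟩ := hF y hy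
  have flip : ∀ a b : Fin n → ℝ, b ∈ F → enorm2 (a - b) ≤ 2 * ε →
      (rowCount (signDiff a b) ω : ℝ) ≤ m * (u + v) := fun a b hb hab => by
    have e1 : (rowCount (signDiff a b) ω : ℝ) ≤
        rowCount (smallProj b θ) ω + rowCount (largeProj (a - b) θ) ω := by
      exact_mod_cast rowCount_le_add (signDiff_subset a b θ) ω
    have e2 := h2 b hb
    have e3 := h3 _ hab
    linarith
  have tri : ∀ a b e : Fin n → ℝ, (rowCount (signDiff a e) ω : ℝ) ≤
      rowCount (signDiff a b) ω + rowCount (signDiff b e) ω := fun a b e => by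
    exact_mod_cast rowCount_le_add (signDiff_subset_trans a b e) ω
  have fx := flip x c hc hxc
  have fy := flip y d hd hyd
  have t1 := tri x c y
  have t2 := tri c d y
  have t3 := tri c x d
  have t4 := tri x y d
  rw [signDiff_comm d y] at t2
  rw [signDiff_comm c x] at t3
  have hcd := abs_le.1 (h1 c hc d hd)
  have hcount : |(rowCount (signDiff x y) ω : ℝ) - m * (rowLaw n lam).real (signDiff c d)| ≤
      m * (t + 2 * (u + v)) := by
    rw [abs_le]
    constructor <;> nlinarith [hcd.1, hcd.2]
  set p := (rowLaw n lam).real (signDiff c d) with hp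
  have hbias := rowLaw_real_signDiff hl (hF1 c hc) (hF1 d hd)
  rw [← hp] at hbias
  have hdist : |enorm2 (c - d) - enorm2 (x - y)| ≤ 4 * ε := by
    have e1 : enorm2 (x - y) ≤ enorm2 (x - c) + (enorm2 (c - d) + enorm2 (y - d)) := by
      rw [show x - y = (x - c) + ((c - d) + (d - y)) by abel, enorm2_sub_comm y d]
      exact (enorm2_add_le _ _).trans (add_le_add_right (enorm2_add_le _ _) _)
    have e2 : enorm2 (c - d) ≤ enorm2 (x - c) + (enorm2 (x - y) + enorm2 (y - d)) := by
      rw [show c - d = (c - x) + ((x - y) + (y - d)) by abel, enorm2_sub_comm x c]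
      exact (enorm2_add_le _ _).trans (add_le_add_right (enorm2_add_le _ _) _)
    rw [abs_le]
    constructor <;> linarith
  have hs0 : 0 ≤ √(2 * π) := Real.sqrt_nonneg _
  have hss : √(2 * π) * √(2 / π) = 2 := by
    rw [← Real.sqrt_mul (by positivity), show 2 * π * (2 / π) = 2 ^ 2 by field_simp,
      Real.sqrt_sq (by norm_num)]
  have p1 : |√(2 * π) * lam / m * ((rowCount (signDiff x y) ω : ℝ) - m * p)| ≤
      3 * lam * (t + 2 * (u + v)) := by
    rw [abs_mul, abs_of_nonneg (by positivity)]
    have hq : 0 ≤ t + 2 * (u + v) := by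
      have := (abs_nonneg _).trans hcount
      exact nonneg_of_mul_nonneg_right this hm'
    calc _ ≤ √(2 * π) * lam / m * (m * (t + 2 * (u + v))) := by gcongr
      _ = √(2 * π) * lam * (t + 2 * (u + v)) := by field_simp
      _ ≤ _ := by gcongr; exact sqrt_two_pi_le
  have p2 : |√(2 * π) / 2 * (2 * lam * p - √(2 / π) * enorm2 (c - d))| ≤
      6 * Real.exp (-lam ^ 2 / 2) / lam := by
    rw [abs_mul, abs_of_nonneg (by positivity)]
    calc _ ≤ 3 / 2 * (4 * Real.exp (-lam ^ 2 / 2) / lam) := by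
          gcongr; exact sqrt_two_pi_le
      _ = _ := by ring
  have key : √(2 * π) * lam / m * (rowCount (signDiff x y) ω : ℝ) - enorm2 (x - y)
      = √(2 * π) * lam / m * ((rowCount (signDiff x y) ω : ℝ) - m * p)
        + √(2 * π) / 2 * (2 * lam * p - √(2 / π) * enorm2 (c - d))
        + (enorm2 (c - d) - enorm2 (x - y)) := by
    have : √(2 * π) / 2 * (√(2 / π) * enorm2 (c - d)) = enorm2 (c - d) := by
      rw [← mul_assoc, div_mul_eq_mul_div, hss]; ring
    rw [mul_sub (√(2 * π) / 2), this]
    field_simp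
    ring
  rw [key]
  refine (abs_add_three _ _ _).trans ?_
  linarith

/-- The three exceptional events in the uniform estimate are unlikely. -/
lemma le_measure_good_of_net {m n r : ℕ} (hm : 0 < m) {lam ε θ t u v : ℝ} (hl : 0 < lam)
    (hε : 0 < ε) (ht : 0 ≤ t) (hu : 0 ≤ u) (hv : 0 < v) (hθ : 0 ≤ θ)
    {F : Finset (Fin n → ℝ)} (hF1 : ∀ c ∈ F, enorm2 c ≤ 1)
    (hF : ∀ x ∈ cylSet n r ε, ∃ c ∈ F, enorm2 (x - c) ≤ 2 * ε)
    {δ : ℝ} (hδ : 3 * lam * (t + 2 * ((θ / lam + u) + v)) + 6 * Real.exp (-lam ^ 2 / 2) / lam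
      + 4 * ε ≤ δ) :
    1 ≤ ((gaussianMatrix m n).prod (unifCube m lam))
        {p | ∀ x ∈ cylSet n r ε, ∀ y ∈ cylSet n r ε,
          |√(2 * π) * lam / m * (hamming (signVec (mulVecR p.1 x + p.2))
            (signVec (mulVecR p.1 y + p.2)) : ℝ) - enorm2 (x - y)| ≤ δ}
      + ENNReal.ofReal (F.card ^ 2 * (2 * Real.exp (-2 * m * t ^ 2))
        + F.card * Real.exp (-2 * m * u ^ 2)
        + (2 * Real.exp 1 * m / ⌈m * v⌉₊) ^ ⌈m * v⌉₊ *
        (√2 ^ n * Real.exp (-(⌈m * v⌉₊ * θ ^ 2 / (4 * (2 * ε) ^ 2))))) := by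
  classical
  have hm' : (0 : ℝ) < m := by exact_mod_cast hm
  have hkpos : 0 < ⌈m * v⌉₊ := Nat.ceil_pos.2 (by positivity)
  set k := ⌈m * v⌉₊ with hk
  have := isProbabilityMeasure_rowLaw n hl
  have := isProbabilityMeasure_unifIcc hl
  set P := Measure.pi fun _ : Fin m => rowLaw n lam with hP
  rw [prod_law_apply m n hl]
  set G : Set (Fin m → (Fin n → ℝ) × ℝ) :=
    {ω | ((fun i => (ω i).1), (fun i => (ω i).2)) ∈ {p : (Fin m → Fin n → ℝ) × (Fin m → ℝ) |
      ∀ x ∈ cylSet n r ε, ∀ y ∈ cylSet n r ε,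
          |√(2 * π) * lam / m * (hamming (signVec (mulVecR p.1 x + p.2))
            (signVec (mulVecR p.1 y + p.2)) : ℝ) - enorm2 (x - y)| ≤ δ}} with hG
  set B1 : Set (Fin m → (Fin n → ℝ) × ℝ) := ⋃ x ∈ F, ⋃ y ∈ F,
    {ω | m * t ≤ |(rowCount (signDiff x y) ω : ℝ) - m * (rowLaw n lam).real (signDiff x y)|}
    with hB1
  set B2 : Set (Fin m → (Fin n → ℝ) × ℝ) := ⋃ x ∈ F,
    {ω | m * ((rowLaw n lam).real (smallProj x θ) + u) ≤ (rowCount (smallProj x θ) ω : ℝ)} with hB2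
  set B3 : Set (Fin m → (Fin n → ℝ) × ℝ) :=
    {ω | ∃ z : Fin n → ℝ, enorm2 z ≤ 2 * ε ∧ k ≤ rowCount (largeProj z θ) ω} with hB3
  have hcover : Set.univ ⊆ G ∪ (B1 ∪ B2 ∪ B3) := by
    intro ω _
    by_contra! hbad
    simp only [Set.mem_union, not_or] at hbad
    obtain ⟨hg, ⟨hb1, hb2⟩, hb3⟩ := hbad
    apply hg
    intro x hx y hy
    simp only [hB1, hB2, hB3, Set.mem_iUnion, Set.mem_ofPred_eq, not_exists, not_le, not_and]
      at hb1 hb2 hb3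
    rw [hamming_eq_rowCount]
    refine (abs_hamming_sub_le_of_net (t := t) (u := θ / lam + u) (v := v) (θ := θ) hm hl hF1 hF
      (fun x hx y hy => (hb1 x hx y hy).le) (fun x hx => (hb2 x hx).le.trans ?_)
      (fun z hz => ?_) hx hy).trans hδ
    · have := rowLaw_real_smallProj_le hl x hθ
      gcongr
    · exact (Nat.lt_ceil.1 (hb3 z hz)).le
  have m1 : P B1 ≤ ENNReal.ofReal (F.card ^ 2 * (2 * Real.exp (-2 * m * t ^ 2))) := by
    calc _ ≤ ∑ x ∈ F, ∑ y ∈ F, 2 * ENNReal.ofReal (Real.exp (-2 * m * t ^ 2)) := by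
          refine (measure_biUnion_finset_le _ _).trans (Finset.sum_le_sum fun x hx => ?_)
          refine (measure_biUnion_finset_le _ _).trans (Finset.sum_le_sum fun y hy => ?_)
          exact hoeffding_count_abs (rowLaw n lam) m hm (measurableSet_signDiff x y) ht
      _ = _ := by
          simp only [Finset.sum_const, nsmul_eq_mul]
          rw [ENNReal.ofReal_mul (by positivity), ENNReal.ofReal_mul (by norm_num),
            ENNReal.ofReal_pow (by positivity)]
          simp only [ENNReal.ofReal_natCast, ENNReal.ofReal_ofNat]
          ring
  have m2 : P B2 ≤ ENNReal.ofReal (F.card * Real.exp (-2 * m * u ^ 2)) := by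
    calc _ ≤ ∑ x ∈ F, ENNReal.ofReal (Real.exp (-2 * m * u ^ 2)) := by
          refine (measure_biUnion_finset_le _ _).trans (Finset.sum_le_sum fun x hx => ?_)
          exact hoeffding_count (rowLaw n lam) m hm (measurableSet_smallProj x θ) hu
      _ = _ := by
          simp only [Finset.sum_const, nsmul_eq_mul]
          rw [ENNReal.ofReal_mul (by positivity), ENNReal.ofReal_natCast]
  have m3 : P B3 ≤ ENNReal.ofReal ((2 * Real.exp 1 * m / k) ^ k *
        (√2 ^ n * Real.exp (-(k * θ ^ 2 / (4 * (2 * ε) ^ 2))))) := by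
    refine le_trans (le_of_eq ?_)
      (gaussianMatrix_exists_many_large_le (m := m) (n := n) hkpos hθ (ρ := 2 * ε) (by positivity))
    set B := {A : Fin m → Fin n → ℝ | ∃ z : Fin n → ℝ, enorm2 z ≤ 2 * ε ∧
        k ≤ (Finset.univ.filter fun i => θ ≤ |ip (A i) z|).card} with hB
    have e : (gaussianMatrix m n).prod (unifCube m lam) (B ×ˢ Set.univ) = P B3 := by
      rw [prod_law_apply m n hl]
      congr 1
      ext ω
      simp only [hB, hB3, Set.mem_prod, Set.mem_univ, and_true, Set.mem_ofPred_eq]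
      refine exists_congr fun z => and_congr_right fun _ => ?_
      have : rowCount (largeProj z θ) ω =
          (Finset.univ.filter fun i => θ ≤ |ip (ω i).1 z|).card := by
        refine congrArg Finset.card (Finset.ext fun i => ?_)
        rw [Finset.mem_filter, Finset.mem_filter]
        rfl
      rw [this]
    rw [← e, Measure.prod_prod, unifCube_eq_pi m hl]
    simp
  calc (1 : ENNReal) = P Set.univ := by simp
    _ ≤ P G + (P B1 + P B2 + P B3) := by
        refine (measure_mono hcover).trans ((measure_union_le _ _).trans ?_)
        gcongr
        refine (measure_union_le _ _).trans ?_
        gcongr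
        exact measure_union_le _ _
    _ ≤ _ := by
        rw [ENNReal.ofReal_add (by positivity) (by positivity),
          ENNReal.ofReal_add (by positivity) (by positivity)]
        gcongr

lemma log_exp_one_div_facts {δ : ℝ} (hδ : 0 < δ) (hδ1 : δ ≤ 1) :
    1 ≤ Real.log (Real.exp 1 / δ) ∧ δ = Real.exp (1 - Real.log (Real.exp 1 / δ)) ∧
      Real.log (Real.exp 1 / δ) ^ 2 * δ ≤ 4 := by
  have h1 : Real.log (Real.exp 1 / δ) = 1 - Real.log δ := by
    rw [Real.log_div (Real.exp_pos 1).ne' hδ.ne', Real.log_exp]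
  set L := Real.log (Real.exp 1 / δ) with hL
  have h2 : δ = Real.exp (1 - L) := by
    rw [h1, sub_sub_cancel, Real.exp_log hδ]
  have h3 : 1 ≤ L := by
    rw [h1]; linarith [Real.log_nonpos hδ.le hδ1]
  refine ⟨h3, h2, ?_⟩
  have h4 := Real.add_one_le_exp ((L - 1) / 2)
  have h5 : Real.exp ((L - 1) / 2) ^ 2 * δ = 1 := by
    nth_rewrite 1 [h2]
    rw [← Real.exp_nat_mul, ← Real.exp_add, Real.exp_eq_one_iff]
    push_cast; ring
  have h6 : (L / 2) ^ 2 ≤ Real.exp ((L - 1) / 2) ^ 2 := by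
    apply pow_le_pow_left₀ (by linarith); linarith
  nlinarith

lemma uniform_estimate_le_exp {n k : ℕ} {M L s δ ρ θ : ℝ} (hM : 0 < M)
    (hL : 1 ≤ L) (hs : 1 ≤ s) (hsL : s ≤ L) (hδ : 0 < δ)
    (hδL : δ = Real.exp (1 - L)) (hk : 0 < k) (hkM : M * (δ / (200 * s)) ≤ k)
    (hn : (n : ℝ) ≤ k * L ^ 2) (hθ : θ ^ 2 / (4 * ρ ^ 2) = 100 * L ^ 2) :
    (2 * Real.exp 1 * M / k) ^ k * (√2 ^ n * Real.exp (-(k * θ ^ 2 / (4 * ρ ^ 2)))) ≤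
      Real.exp (-10) := by
  have hk1 : (1 : ℝ) ≤ k := by exact_mod_cast hk
  have hk0 : (0 : ℝ) < k := by linarith
  have he : (2.7 : ℝ) ≤ Real.exp 1 := by linarith [Real.exp_one_gt_d9]
  have h400 : (400 : ℝ) ≤ Real.exp 7 := by
    have : Real.exp 7 = Real.exp 1 ^ 7 := by rw [← Real.exp_nat_mul]; norm_num
    rw [this]
    calc (400 : ℝ) ≤ 2.7 ^ 7 := by norm_num
      _ ≤ _ := by gcongr
  have hLe : L ≤ Real.exp (L - 1) := by linarith [Real.add_one_le_exp (L - 1)]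
  have hδi : 1 / δ = Real.exp (L - 1) := by
    rw [hδL, one_div, ← Real.exp_neg]; congr 1; ring
  have b1 : 2 * Real.exp 1 * M / k ≤ Real.exp (8 * L) := by
    have e1 : M / k ≤ 200 * s / δ := by
      rw [div_le_div_iff₀ hk0 hδ]
      have : M * (δ / (200 * s)) * (200 * s) ≤ k * (200 * s) := by gcongr
      have e2 : M * (δ / (200 * s)) * (200 * s) = M * δ := by field_simp
      linarith
    calc 2 * Real.exp 1 * M / k = 2 * Real.exp 1 * (M / k) := by ring
      _ ≤ 2 * Real.exp 1 * (200 * s / δ) := by gcongr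
      _ = 400 * Real.exp 1 * s * (1 / δ) := by ring
      _ ≤ Real.exp 7 * Real.exp 1 * Real.exp (L - 1) * Real.exp (L - 1) := by
          rw [hδi]; gcongr; exact hsL.trans hLe
      _ = Real.exp (6 + 2 * L) := by
          rw [← Real.exp_add, ← Real.exp_add, ← Real.exp_add]; congr 1; ring
      _ ≤ _ := Real.exp_le_exp.2 (by linarith)
  have b2 : √2 ≤ Real.exp 1 := by
    rw [Real.sqrt_le_left (by linarith)]; nlinarith
  have hL2 : 1 ≤ L ^ 2 := by nlinarith
  have hLL : L ≤ L ^ 2 := by nlinarith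
  calc _ ≤ Real.exp (8 * L) ^ k * (Real.exp 1 ^ n * Real.exp (-(k * θ ^ 2 / (4 * ρ ^ 2)))) := by
        gcongr
    _ = Real.exp (k * (8 * L) + (n * 1 - k * (100 * L ^ 2))) := by
        rw [← Real.exp_nat_mul, ← Real.exp_nat_mul, ← Real.exp_add, ← Real.exp_add, mul_div_assoc,
          hθ]
        congr 1
    _ ≤ _ := by
        apply Real.exp_le_exp.2
        have e1 : k * (8 * L) ≤ k * (8 * L ^ 2) := by gcongr
        have e2 : (1 : ℝ) * 1 ≤ k * L ^ 2 := by gcongr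
        linarith

/-- The uniform estimate holds with probability at least `0.9` once `m` is large. -/
lemma uniform_hamming_estimate {r m n : ℕ} {δ ε lam L : ℝ} (hr : 0 < r) (hδ : 0 < δ)
    (hδ1 : δ ≤ 1 / 1000) (hL : L = Real.log (Real.exp 1 / δ)) (hε : ε = 1 / 4000 * δ / L)
    (hn : (n : ℝ) ≤ r * L ^ 2 / δ ^ 2) (hlam : lam = 2 * √L)
    (hm : 5 * 10 ^ 6 * √L * r / δ ^ 3 ≤ m) :
    ENNReal.ofReal 0.9 ≤ ((gaussianMatrix m n).prod (unifCube m lam))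
        {p | ∀ x ∈ cylSet n r ε, ∀ y ∈ cylSet n r ε,
          |√(2 * π) * lam / m * (hamming (signVec (mulVecR p.1 x + p.2))
            (signVec (mulVecR p.1 y + p.2)) : ℝ) - enorm2 (x - y)| ≤ δ} := by
  obtain ⟨hL1, hδL, hLδ⟩ := log_exp_one_div_facts hδ (by linarith)
  rw [← hL] at hL1 hδL hLδ
  set s := √L with hs
  have hs2 : s ^ 2 = L := Real.sq_sqrt (by linarith)
  have hs1 : 1 ≤ s := by rw [hs, Real.one_le_sqrt]; exact hL1
  have hsL : s ≤ L := by nlinarith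
  have hs0 : 0 < s := by linarith
  have hL0 : 0 < L := by linarith
  have hr1 : (1 : ℝ) ≤ r := by exact_mod_cast hr
  have hr0 : (0 : ℝ) < r := by linarith
  have hm0 : (0 : ℝ) < m := lt_of_lt_of_le (by positivity) hm
  have hmpos : 0 < m := by exact_mod_cast hm0
  have hl0 : 0 < lam := by rw [hlam]; positivity
  have hε0 : 0 < ε := by rw [hε]; positivity
  have hεδ : ε ≤ δ / 4000 := by
    rw [hε]; calc _ ≤ 1 / 4000 * δ / 1 := by gcongr
      _ = _ := by ring
  obtain ⟨F, hFc, hF1, hF⟩ := exists_net_cylSet n r hε0 (by linarith)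
  have herr : 3 * lam * (δ / (60 * s) + 2 * ((δ / 100 / lam + δ / (200 * s)) + δ / (200 * s)))
      + 6 * Real.exp (-lam ^ 2 / 2) / lam + 4 * ε ≤ δ := by
    have e1 : 3 * lam * (δ / (60 * s) + 2 * ((δ / 100 / lam + δ / (200 * s)) + δ / (200 * s)))
        = 28 / 100 * δ := by
      rw [hlam]; field_simp; ring
    have e2 : 6 * Real.exp (-lam ^ 2 / 2) / lam ≤ δ / 10 := by
      have e3 : Real.exp (-lam ^ 2 / 2) ≤ δ ^ 2 := by
        rw [hδL, ← Real.exp_nat_mul, hlam, mul_pow, hs2]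
        apply Real.exp_le_exp.2
        push_cast; linarith
      calc 6 * Real.exp (-lam ^ 2 / 2) / lam ≤ 6 * δ ^ 2 / 1 := by
            gcongr; rw [hlam]; linarith
        _ ≤ _ := by nlinarith
    rw [e1]; linarith
  have main := le_measure_good_of_net (n := n) (r := r) (F := F) (θ := δ / 100) (t := δ / (60 * s))
    (u := δ / (200 * s)) (v := δ / (200 * s)) hmpos hl0 hε0 (by positivity) (by positivity)
    (by positivity) (by positivity) hF1 hF herr
  set k := ⌈(m : ℝ) * (δ / (200 * s))⌉₊ with hk
  have hkm : m * (δ / (200 * s)) ≤ k := Nat.le_ceil _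
  have hkpos : 0 < k := Nat.ceil_pos.2 (by positivity)
  have hkr : 25000 * r / δ ^ 2 ≤ (k : ℝ) := by
    refine le_trans ?_ hkm
    calc 25000 * r / δ ^ 2 = (5 * 10 ^ 6 * s * r / δ ^ 3) * (δ / (200 * s)) := by
          field_simp; norm_num
      _ ≤ _ := by gcongr
  have hnk : (n : ℝ) ≤ k * L ^ 2 := by
    calc (n : ℝ) ≤ r * L ^ 2 / δ ^ 2 := hn
      _ = r / δ ^ 2 * L ^ 2 := by ring
      _ ≤ (25000 * r / δ ^ 2) * L ^ 2 := by gcongr; linarith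
      _ ≤ _ := by gcongr
  have b3 := uniform_estimate_le_exp (n := n) (k := k) (M := m) (L := L) (s := s) (δ := δ)
    (ρ := 2 * ε) (θ := δ / 100) hm0 hL1 hs1 hsL hδ hδL hkpos hkm hnk (by
      rw [hε]; field_simp; norm_num)
  have he : (2.7 : ℝ) ≤ Real.exp 1 := by linarith [Real.exp_one_gt_d9]
  have hexp10 : (12000 : ℝ) ≤ Real.exp 10 := by
    have : Real.exp 10 = Real.exp 1 ^ 10 := by rw [← Real.exp_nat_mul]; norm_num
    rw [this]
    calc (12000 : ℝ) ≤ 2.7 ^ 10 := by norm_num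
      _ ≤ _ := by gcongr
  have hcard : (F.card : ℝ) ≤ Real.exp (10 * (r * L)) := by
    have hδi : 1 / δ = Real.exp (L - 1) := by
      rw [hδL, one_div, ← Real.exp_neg]; congr 1; ring
    have hLe : L ≤ Real.exp (L - 1) := by linarith [Real.add_one_le_exp (L - 1)]
    calc (F.card : ℝ) ≤ (3 / ε) ^ r := hFc
      _ ≤ Real.exp (10 * L) ^ r := by
          gcongr
          calc 3 / ε = 12000 * L * (1 / δ) := by rw [hε]; field_simp; norm_num
            _ ≤ Real.exp 10 * Real.exp (L - 1) * Real.exp (L - 1) := by rw [hδi]; gcongr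
            _ = Real.exp (8 + 2 * L) := by
                rw [← Real.exp_add, ← Real.exp_add]; congr 1; ring
            _ ≤ _ := Real.exp_le_exp.2 (by linarith)
      _ = _ := by rw [← Real.exp_nat_mul]; congr 1; ring
  have hrL : 1 ≤ r * L := by nlinarith
  have hbase : r * L * L ≤ r * (4 * s) / δ := by
    rw [le_div_iff₀ hδ]
    calc r * L * L * δ = r * (L ^ 2 * δ) := by ring
      _ ≤ r * 4 := by gcongr
      _ ≤ r * (4 * s) := by gcongr; linarith
  have b1 : 30 * (r * L) ≤ 2 * m * (δ / (60 * s)) ^ 2 := by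
    calc 30 * (r * L) = 30 * (r * L * L) / L := by field_simp
      _ ≤ 30 * (r * (4 * s) / δ) / L := by gcongr
      _ = 120 * (r * s / (δ * L)) := by field_simp; norm_num
      _ ≤ (10 ^ 7 / 3600) * (r * s / (δ * L)) := by gcongr; norm_num
      _ = 2 * (5 * 10 ^ 6 * s * r / δ ^ 3) * (δ / (60 * s)) ^ 2 := by
          rw [div_pow, mul_pow, hs2]; field_simp; norm_num
      _ ≤ _ := by gcongr
  have b2 : 20 * (r * L) ≤ 2 * m * (δ / (200 * s)) ^ 2 := by
    calc 20 * (r * L) = 20 * (r * L * L) / L := by field_simp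
      _ ≤ 20 * (r * (4 * s) / δ) / L := by gcongr
      _ = 80 * (r * s / (δ * L)) := by field_simp; norm_num
      _ ≤ (10 ^ 7 / 40000) * (r * s / (δ * L)) := by gcongr; norm_num
      _ = 2 * (5 * 10 ^ 6 * s * r / δ ^ 3) * (δ / (200 * s)) ^ 2 := by
          rw [div_pow, mul_pow, hs2]; field_simp; norm_num
      _ ≤ _ := by gcongr
  have c1 : F.card ^ 2 * (2 * Real.exp (-2 * m * (δ / (60 * s)) ^ 2)) ≤ 2 * Real.exp (-10) := by
    calc _ ≤ Real.exp (10 * (r * L)) ^ 2 * (2 * Real.exp (-2 * m * (δ / (60 * s)) ^ 2)) :=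
          mul_le_mul_of_nonneg_right (pow_le_pow_left₀ (Nat.cast_nonneg _) hcard 2) (by positivity)
      _ = 2 * Real.exp (20 * (r * L) - 2 * m * (δ / (60 * s)) ^ 2) := by
          rw [← Real.exp_nat_mul, mul_left_comm, ← Real.exp_add]
          congr 2; push_cast; ring
      _ ≤ _ := by gcongr; linarith
  have c2 : F.card * Real.exp (-2 * m * (δ / (200 * s)) ^ 2) ≤ Real.exp (-10) := by
    calc _ ≤ Real.exp (10 * (r * L)) * Real.exp (-2 * m * (δ / (200 * s)) ^ 2) :=
          mul_le_mul_of_nonneg_right hcard (by positivity)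
      _ = Real.exp (10 * (r * L) - 2 * m * (δ / (200 * s)) ^ 2) := by
          rw [← Real.exp_add]
          congr 1; ring
      _ ≤ _ := by gcongr; linarith
  have hten : Real.exp (-10) ≤ 1 / 12000 := by
    rw [Real.exp_neg, ← one_div]
    gcongr
  have htot : ENNReal.ofReal 0.9 + ENNReal.ofReal 0.1 ≤ ((gaussianMatrix m n).prod (unifCube m lam))
        {p | ∀ x ∈ cylSet n r ε, ∀ y ∈ cylSet n r ε,
          |√(2 * π) * lam / m * (hamming (signVec (mulVecR p.1 x + p.2))
            (signVec (mulVecR p.1 y + p.2)) : ℝ) - enorm2 (x - y)| ≤ δ} + ENNReal.ofReal 0.1 := by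
    rw [← ENNReal.ofReal_add (by norm_num) (by norm_num),
      show (0.9 + 0.1 : ℝ) = 1 by norm_num, ENNReal.ofReal_one]
    refine main.trans ?_
    gcongr
    linarith
  exact (ENNReal.add_le_add_iff_right ENNReal.ofReal_ne_top).1 htot

section SecondMoment

variable {M : ℕ} {X : Type*} [MeasurableSpace X] (ν : Measure X) [IsProbabilityMeasure ν]
  {f : Fin M → X → ℝ}

lemma memLp_sum_pi (hf : ∀ i, MemLp (f i) 2 ν) :
    MemLp (fun ω : Fin M → X => ∑ i, f i (ω i)) 2 (Measure.pi fun _ => ν) :=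
  memLp_finsetSum _ fun i _ =>
    (hf i).comp_measurePreserving (measurePreserving_eval (fun _ : Fin M => ν) i)

lemma integral_sum_pi (hf : ∀ i, MemLp (f i) 2 ν) :
    ∫ ω : Fin M → X, ∑ i, f i (ω i) ∂(Measure.pi fun _ => ν) = ∑ i, ∫ x, f i x ∂ν := by
  rw [integral_finsetSum _ fun i _ => integrable_comp_eval (X := fun _ : Fin M => X)
    (μ := fun _ => ν) (i := i) ((hf i).integrable one_le_two)]
  exact Finset.sum_congr rfl fun i _ => integral_comp_eval (X := fun _ : Fin M => X)
    (μ := fun _ => ν) (i := i) (hf i).aestronglyMeasurable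

lemma variance_sum_pi_le (hf : ∀ i, MemLp (f i) 2 ν) :
    Var[fun ω : Fin M → X => ∑ i, f i (ω i); Measure.pi fun _ => ν] ≤
      ∑ i, ∫ x, f i x ^ 2 ∂ν := by
  have h := variance_sum_pi (μ := fun _ : Fin M => ν) hf
  have e : (∑ i, fun ω : Fin M → X => f i (ω i)) = fun ω : Fin M → X => ∑ i, f i (ω i) := by
    ext ω; simp
  rw [e] at h
  rw [h]
  exact Finset.sum_le_sum fun i _ => variance_le_expectation_sq (hf i).aestronglyMeasurable

lemma integral_sq_sum_sub_le (hf : ∀ i, MemLp (f i) 2 ν) :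
    ∫ ω : Fin M → X, (∑ i, f i (ω i) - ∑ i, ∫ x, f i x ∂ν) ^ 2 ∂(Measure.pi fun _ => ν) ≤
      ∑ i, ∫ x, f i x ^ 2 ∂ν := by
  have h := variance_sum_pi_le ν hf
  rwa [variance_eq_integral (memLp_sum_pi ν hf).aestronglyMeasurable.aemeasurable,
    integral_sum_pi ν hf] at h

end SecondMoment

lemma ip_add_right {n : ℕ} (g x y : Fin n → ℝ) : ip g (x + y) = ip g x + ip g y := by
  simp [ip, mul_add, Finset.sum_add_distrib]

lemma integrable_ip_pow {n : ℕ} (x : Fin n → ℝ) (k : ℕ) :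
    Integrable (fun g => ip g x ^ k) (gaussianPi n) := by
  refine integrable_gaussianPi_comp_ip x (φ := fun y => y ^ k) (by fun_prop) ?_
  simp_rw [mul_pow]
  exact (integrable_pow_gaussianReal k).const_mul _

lemma integral_ip_sq {n : ℕ} (x : Fin n → ℝ) :
    ∫ g, ip g x ^ 2 ∂(gaussianPi n) = enorm2 x ^ 2 := by
  rw [integral_gaussianPi_comp_ip x (φ := fun y => y ^ 2) (by fun_prop)]
  simp_rw [mul_pow]
  rw [integral_const_mul, integral_sq_gaussianReal, mul_one]

lemma integral_ip_pow_four_le {n : ℕ} (x : Fin n → ℝ) :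
    ∫ g, ip g x ^ 4 ∂(gaussianPi n) ≤ 80 * enorm2 x ^ 4 := by
  rw [integral_gaussianPi_comp_ip x (φ := fun y => y ^ 4) (by fun_prop)]
  simp_rw [mul_pow]
  rw [integral_const_mul, mul_comm]
  gcongr
  exact integral_pow_four_gaussianReal_le

lemma integral_ip_mul_ip {n : ℕ} (x y : Fin n → ℝ) :
    ∫ g, ip g x * ip g y ∂(gaussianPi n) = ip x y := by
  have h : ∀ g, ip g x * ip g y = 4⁻¹ * (ip g (x + y) ^ 2 - ip g (x - y) ^ 2) := fun g => by
    rw [ip_add_right, ip_sub]; ring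
  simp_rw [h]
  rw [integral_const_mul, integral_sub (integrable_ip_pow _ 2) (integrable_ip_pow _ 2),
    integral_ip_sq, integral_ip_sq, enorm2_sq, enorm2_sq, ← Finset.sum_sub_distrib, Finset.mul_sum]
  refine Finset.sum_congr rfl fun i _ => ?_
  simp only [Pi.add_apply, Pi.sub_apply]
  ring

lemma integral_ip_mul_ip_sq_le {n : ℕ} (x y : Fin n → ℝ) (hx : enorm2 x = 1)
    (hy : 0 < enorm2 y) :
    MemLp (fun g => ip g x * ip g y) 2 (gaussianPi n) ∧
    ∫ g, (ip g x * ip g y) ^ 2 ∂(gaussianPi n) ≤ 80 * enorm2 y ^ 2 := by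
  set k := enorm2 y with hk
  have hmx := measurable_ip x
  have hmy := measurable_ip y
  have hp : ∀ g, (ip g x * ip g y) ^ 2 ≤ k ^ 2 / 2 * ip g x ^ 4 + (2 * k ^ 2)⁻¹ * ip g y ^ 4 := by
    intro g
    have : k ^ 2 / 2 * ip g x ^ 4 + (2 * k ^ 2)⁻¹ * ip g y ^ 4 - (ip g x * ip g y) ^ 2
        = (k ^ 2 * ip g x ^ 2 - ip g y ^ 2) ^ 2 / (2 * k ^ 2) := by field_simp; ring
    have h2 : 0 ≤ (k ^ 2 * ip g x ^ 2 - ip g y ^ 2) ^ 2 / (2 * k ^ 2) := by positivity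
    linarith
  have hb : Integrable (fun g => k ^ 2 / 2 * ip g x ^ 4 + (2 * k ^ 2)⁻¹ * ip g y ^ 4)
      (gaussianPi n) :=
    ((integrable_ip_pow x 4).const_mul _).add ((integrable_ip_pow y 4).const_mul _)
  have hi : Integrable (fun g => (ip g x * ip g y) ^ 2) (gaussianPi n) := by
    refine hb.mono' (by fun_prop) (Filter.Eventually.of_forall fun g => ?_)
    rw [Real.norm_eq_abs, abs_of_nonneg (sq_nonneg _)]
    exact hp g
  refine ⟨(memLp_two_iff_integrable_sq (by fun_prop)).2 hi, ?_⟩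
  calc _ ≤ ∫ g, (k ^ 2 / 2 * ip g x ^ 4 + (2 * k ^ 2)⁻¹ * ip g y ^ 4) ∂(gaussianPi n) :=
        integral_mono hi hb hp
    _ ≤ k ^ 2 / 2 * (80 * enorm2 x ^ 4) + (2 * k ^ 2)⁻¹ * (80 * k ^ 4) := by
        rw [integral_add ((integrable_ip_pow x 4).const_mul _)
          ((integrable_ip_pow y 4).const_mul _), integral_const_mul, integral_const_mul]
        gcongr
        · exact integral_ip_pow_four_le x
        · exact integral_ip_pow_four_le y
    _ = _ := by rw [hx]; field_simp; ring

/-- Indicator vector of a finite set of coordinates. -/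
def indVec {m : ℕ} (S : Finset (Fin m)) : Fin m → ℝ := fun i => if i ∈ S then 1 else 0

lemma enorm2_indVec_sq {m : ℕ} (S : Finset (Fin m)) : enorm2 (indVec S) ^ 2 = S.card := by
  rw [enorm2_sq]
  have : ∀ i, indVec S i ^ 2 = if i ∈ S then 1 else 0 := fun i => by
    unfold indVec; split_ifs <;> norm_num
  simp [this]

lemma ip_indVec_singleton {m : ℕ} (b : Fin m → ℝ) (i : Fin m) : ip b (indVec {i}) = b i := by
  simp [ip, indVec]

/-- For a fixed set `S` of rows, the sum of the rows in `S`, restricted to the coordinates in `J`,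
has the expected norm and the expected correlation with most of the rows in `S`. -/
lemma gaussianMatrix_row_sum_bad_le {m n : ℕ} {S : Finset (Fin m)} {J : Finset (Fin n)}
    (hS : S.Nonempty) (hJ : J.Nonempty) :
    gaussianMatrix m n {A | 100 * (S.card * J.card : ℝ) ≤ normOn J (rowComb (indVec S) A) ^ 2 ∨
      (S.card * J.card ^ 2 / 8 : ℝ) ≤
        ∑ i ∈ S, (∑ l ∈ J, A i l * rowComb (indVec S) A l - J.card) ^ 2} ≤
      ENNReal.ofReal (1 / 100 + 640 * S.card / J.card) := by
  have hk : (0 : ℝ) < S.card := by exact_mod_cast hS.card_pos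
  have hN : (0 : ℝ) < J.card := by exact_mod_cast hJ.card_pos
  set k : ℝ := (S.card : ℝ) with hkdef
  set N : ℝ := (J.card : ℝ) with hNdef
  set a := indVec S with ha
  have ha2 : enorm2 a ^ 2 = k := enorm2_indVec_sq S
  have ha0 : 0 < enorm2 a := by
    refine lt_of_le_of_ne (enorm2_nonneg a) fun h => ?_
    rw [← h] at ha2; norm_num at ha2; linarith
  set P : (Fin n → Fin m → ℝ) → ℝ := fun B => ∑ l ∈ J, ip (B l) a ^ 2 with hP
  set Q : (Fin n → Fin m → ℝ) → ℝ :=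
    fun B => ∑ i ∈ S, (∑ l ∈ J, B l i * ip (B l) a - N) ^ 2 with hQ
  have hPl : ∀ l ∈ J, Integrable (fun B : Fin n → Fin m → ℝ => ip (B l) a ^ 2)
      (gaussianMatrix n m) := fun l _ =>
    integrable_comp_eval (X := fun _ : Fin n => Fin m → ℝ) (μ := fun _ => gaussianPi m) (i := l)
      (f := fun b => ip b a ^ 2) (integrable_ip_pow a 2)
  have hPi : Integrable P (gaussianMatrix n m) := integrable_finsetSum _ hPl
  have hPv : ∫ B, P B ∂(gaussianMatrix n m) = k * N := by
    rw [hP, integral_finsetSum _ hPl]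
    have : ∀ l : Fin n, ∫ B, ip (B l) a ^ 2 ∂(gaussianMatrix n m) = k := fun l => by
      rw [← ha2, ← integral_ip_sq]
      exact integral_comp_eval (X := fun _ : Fin n => Fin m → ℝ) (μ := fun _ => gaussianPi m)
        (i := l) (f := fun b => ip b a ^ 2) (integrable_ip_pow a 2).aestronglyMeasurable
    simp only [this, Finset.sum_const, nsmul_eq_mul]
    ring
  have hQi : ∀ i ∈ S, Integrable (fun B : Fin n → Fin m → ℝ =>
      (∑ l ∈ J, B l i * ip (B l) a - N) ^ 2) (gaussianMatrix n m) ∧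
      ∫ B : Fin n → Fin m → ℝ, (∑ l ∈ J, B l i * ip (B l) a - N) ^ 2 ∂(gaussianMatrix n m)
        ≤ 80 * k * N := by
    intro i hi
    classical
    set f : Fin n → (Fin m → ℝ) → ℝ :=
      fun l b => if l ∈ J then ip b (indVec {i}) * ip b a else 0 with hf
    obtain ⟨q1, q2⟩ := integral_ip_mul_ip_sq_le (indVec {i}) a
      (by rw [← Real.sqrt_sq (enorm2_nonneg _), enorm2_indVec_sq]; simp) ha0
    have hfm : ∀ l, MemLp (f l) 2 (gaussianPi m) := fun l => by
      by_cases hl : l ∈ J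
      · simpa [hf, hl] using q1
      · simp [hf, hl]
    have hone : ip (indVec {i}) a = 1 := by
      simp [ip, indVec, ha, hi]
    have hmean : ∑ l, ∫ b, f l b ∂(gaussianPi m) = N := by
      have : ∀ l, ∫ b, f l b ∂(gaussianPi m) = if l ∈ J then 1 else 0 := fun l => by
        by_cases hl : l ∈ J
        · simp [hf, hl, integral_ip_mul_ip, hone]
        · simp [hf, hl]
      simp [this, hNdef]
    have hsq : ∑ l, ∫ b, f l b ^ 2 ∂(gaussianPi m) ≤ 80 * k * N := by
      have : ∀ l, ∫ b, f l b ^ 2 ∂(gaussianPi m) ≤ if l ∈ J then 80 * k else 0 := fun l => by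
        by_cases hl : l ∈ J
        · simpa [hf, hl, ← ha2] using q2
        · simp [hf, hl]
      refine (Finset.sum_le_sum fun l _ => this l).trans (le_of_eq ?_)
      simp [hNdef, mul_comm]
    have hsum : ∀ B : Fin n → Fin m → ℝ,
        ∑ l, f l (B l) = ∑ l ∈ J, B l i * ip (B l) a := fun B => by
      simp [hf, ip_indVec_singleton, Finset.sum_ite_mem]
    have h1 := ((memLp_sum_pi (gaussianPi m) hfm).sub (memLp_const N)).integrable_sq
    have h2 := integral_sq_sum_sub_le (gaussianPi m) hfm
    simp only [hmean, hsum, Pi.sub_apply] at h1 h2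
    exact ⟨h1, h2.trans hsq⟩
  have hQint : Integrable Q (gaussianMatrix n m) := integrable_finsetSum _ fun i hi => (hQi i hi).1
  have hQv : ∫ B, Q B ∂(gaussianMatrix n m) ≤ 80 * k ^ 2 * N := by
    rw [hQ, integral_finsetSum _ fun i hi => (hQi i hi).1]
    refine (Finset.sum_le_sum fun i hi => (hQi i hi).2).trans (le_of_eq ?_)
    rw [Finset.sum_const, nsmul_eq_mul, ← hkdef]
    ring
  have m1 := mul_meas_ge_le_integral_of_nonneg (μ := gaussianMatrix n m) (f := P)
    (Filter.Eventually.of_forall fun B => Finset.sum_nonneg fun _ _ => sq_nonneg _) hPi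
    (100 * (k * N))
  have m2 := mul_meas_ge_le_integral_of_nonneg (μ := gaussianMatrix n m) (f := Q)
    (Filter.Eventually.of_forall fun B => Finset.sum_nonneg fun _ _ => sq_nonneg _) hQint
    (k * N ^ 2 / 8)
  have e1 : (gaussianMatrix n m).real {B | 100 * (k * N) ≤ P B} ≤ 1 / 100 := by
    rw [hPv] at m1
    have hkN : 0 < k * N := by positivity
    nlinarith
  have e2 : (gaussianMatrix n m).real {B | k * N ^ 2 / 8 ≤ Q B} ≤ 640 * k / N := by
    rw [le_div_iff₀ hN]
    have hkN : 0 < k * N := by positivity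
    have := m2.trans hQv
    nlinarith
  have hmp := gaussianMatrix_map_transpose n m
  have hms : MeasurableSet {A : Fin m → Fin n → ℝ |
      100 * (k * N) ≤ normOn J (rowComb a A) ^ 2 ∨
      k * N ^ 2 / 8 ≤ ∑ i ∈ S, (∑ l ∈ J, A i l * rowComb a A l - N) ^ 2} := by
    simp only [normOn_sq, rowComb]
    rw [Set.ofPred_or]
    refine (measurableSet_le measurable_const ?_).union (measurableSet_le measurable_const ?_) <;>
      fun_prop
  rw [← hmp.measure_preimage hms.nullMeasurableSet]
  refine ENNReal.le_ofReal_iff_toReal_le (measure_ne_top _ _) (by positivity) |>.2 ?_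
  change (gaussianMatrix n m).real _ ≤ _
  refine (measureReal_mono (s₂ := {B | 100 * (k * N) ≤ P B} ∪ {B | k * N ^ 2 / 8 ≤ Q B}) ?_).trans
    ((measureReal_union_le _ _).trans (add_le_add e1 e2))
  intro B hB
  simpa only [Set.mem_preimage, Set.mem_ofPred_eq, Set.mem_union, normOn_sq, rowComb_transpose,
    hP, hQ] using hB

/-- If the rows in `S` have small dithers, and their sum is well correlated with most of them, then
two points of `cylSet n r ε` at distance `2 * ε` are separated by at least half of these rows. -/
lemma exists_separated_of_rows {m n r : ℕ} {ε θ : ℝ} (A : Fin m → Fin n → ℝ) (τ : Fin m → ℝ)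
    {S : Finset (Fin m)} (hS : S.Nonempty) (hJ : (highIdx n r).Nonempty) (hε : 0 < ε)
    (hτ : ∀ i ∈ S, |τ i| ≤ θ) (hθ : 400 * S.card * θ ^ 2 < ε ^ 2 * (highIdx n r).card)
    (hP : normOn (highIdx n r) (rowComb (indVec S) A) ^ 2 <
      100 * (S.card * (highIdx n r).card : ℝ))
    (hQ : ∑ i ∈ S, (∑ l ∈ highIdx n r, A i l * rowComb (indVec S) A l -
      (highIdx n r).card) ^ 2 < (S.card * (highIdx n r).card ^ 2 / 8 : ℝ)) :
    ∃ x ∈ cylSet n r ε, ∃ y ∈ cylSet n r ε, enorm2 (x - y) ≤ 2 * ε ∧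
      (S.card : ℝ) / 2 ≤ hamming (signVec (mulVecR A x + τ)) (signVec (mulVecR A y + τ)) := by
  classical
  have hk : (0 : ℝ) < S.card := by exact_mod_cast hS.card_pos
  have hN : (0 : ℝ) < (highIdx n r).card := by exact_mod_cast hJ.card_pos
  set k : ℝ := (S.card : ℝ) with hkdef
  set N : ℝ := ((highIdx n r).card : ℝ) with hNdef
  set w := rowComb (indVec S) A with hw
  set s : ℝ := ε / √(100 * (k * N)) with hsdef
  have hs0 : 0 < s := by positivity
  have hs2 : s ^ 2 * (100 * (k * N)) = ε ^ 2 := by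
    rw [hsdef, div_pow, Real.sq_sqrt (by positivity)]
    field_simp
  set v : Fin n → ℝ := fun l => if l ∈ highIdx n r then s * w l else 0 with hv
  have hlow : ∑ l ∈ lowIdx n r, v l ^ 2 = 0 := by
    refine Finset.sum_eq_zero fun l hl => ?_
    have : l ∉ highIdx n r := by
      simp only [lowIdx, highIdx, Finset.mem_filter, Finset.mem_univ, true_and] at hl ⊢
      omega
    simp [hv, this]
  have hhigh : ∑ l ∈ highIdx n r, v l ^ 2 ≤ ε ^ 2 := by
    calc ∑ l ∈ highIdx n r, v l ^ 2 = s ^ 2 * normOn (highIdx n r) w ^ 2 := by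
          rw [normOn_sq, Finset.mul_sum]
          exact Finset.sum_congr rfl fun l hl => by simp [hv, hl, mul_pow]
      _ ≤ s ^ 2 * (100 * (k * N)) := by gcongr
      _ = ε ^ 2 := hs2
  have hmem : v ∈ cylSet n r ε := by
    rw [mem_cylSet]
    unfold normOn
    rw [hlow]
    exact ⟨by simp, Real.sqrt_le_iff.2 ⟨hε.le, hhigh⟩⟩
  have hmem' : -v ∈ cylSet n r ε := by
    simpa [mem_cylSet, normOn] using hmem
  refine ⟨v, hmem, -v, hmem', ?_, ?_⟩
  · have e : v - -v = (2 : ℝ) • v := by ext l; simp; ring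
    rw [e, enorm2_smul, abs_of_pos two_pos]
    gcongr
    refine abs_le_of_sq_le_sq' ?_ hε.le |>.2
    rw [enorm2_sq, ← sum_low_add_sum_high n r, hlow, zero_add]
    exact hhigh
  have hAv : ∀ i, mulVecR A v i = s * ∑ l ∈ highIdx n r, A i l * w l := fun i => by
    simp only [mulVecR, hv, mul_ite, mul_zero, Finset.sum_ite_mem, Finset.univ_inter,
      Finset.mul_sum]
    exact Finset.sum_congr rfl fun l _ => by ring
  have hAv' : ∀ i, mulVecR A (-v) i = -mulVecR A v i := fun i => by
    simp [mulVecR]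
  set B := S.filter fun i => ∑ l ∈ highIdx n r, A i l * w l < N / 2 with hB
  have hBcard : (B.card : ℝ) ≤ k / 2 := by
    have h1 : (B.card : ℝ) * (N ^ 2 / 4) ≤
        ∑ i ∈ S, (∑ l ∈ highIdx n r, A i l * w l - N) ^ 2 := by
      rw [← nsmul_eq_mul]
      refine (Finset.card_nsmul_le_sum B _ _ fun i hi => ?_).trans
        (Finset.sum_le_sum_of_subset_of_nonneg (Finset.filter_subset _ _)
          fun i _ _ => sq_nonneg _)
      have := (Finset.mem_filter.1 hi).2
      nlinarith
    have h2 := h1.trans hQ.le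
    have hN2 : 0 < N ^ 2 := by positivity
    nlinarith
  have hgood : ∀ i ∈ S \ B, θ < mulVecR A v i := by
    intro i hi
    rw [Finset.mem_sdiff, hB, Finset.mem_filter, not_and, not_lt] at hi
    have h1 := hi.2 hi.1
    rw [hAv]
    refine lt_of_lt_of_le ?_ (mul_le_mul_of_nonneg_left h1 hs0.le)
    refine lt_of_pow_lt_pow_left₀ 2 (by positivity) ?_
    have : (s * (N / 2)) ^ 2 * (400 * k) = ε ^ 2 * N := by rw [← hs2]; ring
    nlinarith
  have hsub : S \ B ⊆ Finset.univ.filter fun i =>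
      signVec (mulVecR A v + τ) i ≠ signVec (mulVecR A (-v) + τ) i := by
    intro i hi
    have h1 := hgood i hi
    have h2 := abs_le.1 (hτ i (Finset.mem_sdiff.1 hi).1)
    refine Finset.mem_filter.2 ⟨Finset.mem_univ _, ?_⟩
    simp only [signVec, Pi.add_apply, hAv']
    exact (signPM_ne_iff _ _).2 (Or.inr ⟨by linarith, by linarith⟩)
  have hcard := Finset.card_le_card hsub
  have hsd := Finset.card_sdiff_add_card_eq_card (show B ⊆ S from Finset.filter_subset _ _)
  have hsd' : ((S \ B).card : ℝ) + B.card = k := by rw [hkdef, ← hsd]; push_cast; ring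
  have hcard' : ((S \ B).card : ℝ) ≤
      hamming (signVec (mulVecR A v + τ)) (signVec (mulVecR A (-v) + τ)) := by
    unfold hamming
    exact_mod_cast (hcard.trans (le_of_eq (by congr)))
  linarith

/-- The coordinates at which the dither has size at most `θ`. -/
def smallDither {m : ℕ} (θ : ℝ) (τ : Fin m → ℝ) : Finset (Fin m) :=
  Finset.univ.filter fun i => |τ i| ≤ θ

lemma measurableSet_smallDither_eq {m : ℕ} (θ : ℝ) (S : Finset (Fin m)) :
    MeasurableSet {τ : Fin m → ℝ | smallDither θ τ = S} := by
  have : {τ : Fin m → ℝ | smallDither θ τ = S} =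
      ⋂ i, {τ : Fin m → ℝ | |τ i| ≤ θ ↔ i ∈ S} := by
    ext τ
    simp [smallDither, Finset.ext_iff]
  rw [this]
  refine MeasurableSet.iInter fun i => ?_
  have h : MeasurableSet {τ : Fin m → ℝ | |τ i| ≤ θ} :=
    measurableSet_le (by fun_prop) measurable_const
  by_cases hi : i ∈ S
  · simpa [hi] using h
  · simp only [hi, iff_false]
    exact h.compl

lemma unifCube_card_smallDither_le {m : ℕ} {lam θ : ℝ} (hl : 0 < lam) (hθ : 0 ≤ θ) (hθl : θ ≤ lam)
    (hm : 80 ≤ m * (θ / lam)) :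
    unifCube m lam {τ | m * (θ / lam) / 2 ≤ |((smallDither θ τ).card : ℝ) - m * (θ / lam)|} ≤
      ENNReal.ofReal 0.05 := by
  have := isProbabilityMeasure_unifIcc hl
  set p := θ / lam with hp
  rw [unifCube_eq_pi m hl]
  set f : Fin m → ℝ → ℝ := fun _ => {s : ℝ | |s| ≤ θ}.indicator 1 with hf
  have hms : MeasurableSet {s : ℝ | |s| ≤ θ} := measurableSet_le (by fun_prop) measurable_const
  have hfm : ∀ i, MemLp (f i) 2 (unifIcc lam) := fun i =>
    memLp_indicator_const (c := (1 : ℝ)) 2 hms (Or.inr (measure_ne_top _ _))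
  have hfi : ∀ i, ∫ s, f i s ∂(unifIcc lam) = p := fun i => by
    rw [hf, integral_indicator_one hms, unifIcc_real_abs_le hl hθ hθl]
  have hf2 : ∀ i s, f i s ^ 2 = f i s := fun i s => by
    by_cases h : |s| ≤ θ <;> simp [hf, h]
  have hsum : ∀ τ : Fin m → ℝ, ((smallDither θ τ).card : ℝ) = ∑ i, f i (τ i) := fun τ => by
    simp [smallDither, hf, Set.indicator]
  have hvar := variance_sum_pi_le (unifIcc lam) hfm
  simp_rw [hf2, hfi] at hvar
  have hint := integral_sum_pi (unifIcc lam) hfm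
  simp_rw [hfi] at hint
  simp only [Finset.sum_const, Finset.card_univ, Fintype.card_fin, nsmul_eq_mul] at hvar hint
  have hmp : 0 < m * p := by linarith
  have hch := meas_ge_le_variance_div_sq (memLp_sum_pi (unifIcc lam) hfm)
    (c := m * p / 2) (by positivity)
  rw [hint] at hch
  simp_rw [hsum]
  refine hch.trans (ENNReal.ofReal_le_ofReal ?_)
  calc _ ≤ m * p / (m * p / 2) ^ 2 := by gcongr
    _ = 4 / (m * p) := by field_simp; norm_num
    _ ≤ 4 / 80 := by gcongr
    _ = _ := by norm_num

lemma prod_measure_random_index_le {α β ι : Type*} [MeasurableSpace α] [MeasurableSpace β]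
    (μ : Measure α) (ν : Measure β) [IsProbabilityMeasure μ] [IsProbabilityMeasure ν]
    {σ : β → ι} (hσ : ∀ S, MeasurableSet {τ | σ τ = S}) (B : ι → Set α) (I : Finset ι)
    {b c : ENNReal} (hB : ∀ S ∈ I, μ (B S) ≤ b) (hc : ν {τ | σ τ ∉ I} ≤ c) :
    (μ.prod ν) {p | p.1 ∈ B (σ p.2) ∨ σ p.2 ∉ I} ≤ b + c := by
  have hsub : {p : α × β | p.1 ∈ B (σ p.2) ∨ σ p.2 ∉ I} ⊆
      (⋃ S ∈ I, B S ×ˢ {τ | σ τ = S}) ∪ Set.univ ×ˢ {τ | σ τ ∉ I} := by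
    intro p hp
    by_cases h : σ p.2 ∈ I
    · exact Or.inl (Set.mem_biUnion h ⟨hp.resolve_right (not_not.2 h), rfl⟩)
    · exact Or.inr ⟨trivial, h⟩
  refine (measure_mono hsub).trans ((measure_union_le _ _).trans (add_le_add ?_ ?_))
  · calc _ ≤ ∑ S ∈ I, (μ.prod ν) (B S ×ˢ {τ | σ τ = S}) := measure_biUnion_finset_le _ _
      _ ≤ ∑ S ∈ I, b * ν {τ | σ τ = S} := Finset.sum_le_sum fun S hS => by
          rw [Measure.prod_prod]
          gcongr
          exact hB S hS
      _ = b * ν (⋃ S ∈ I, {τ | σ τ = S}) := by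
          rw [measure_biUnion_finset (fun S _ T _ hST => Set.disjoint_left.2 fun τ h1 h2 =>
            hST (h1.symm.trans h2)) fun S _ => hσ S, Finset.mul_sum]
      _ ≤ b * 1 := by gcongr; exact prob_le_one
      _ = b := mul_one b
  · rw [Measure.prod_prod, measure_univ, one_mul]
    exact hc

lemma two_le_sqrt_two_pi : 2 ≤ √(2 * π) :=
  Real.le_sqrt_of_sq_le (by linarith [Real.pi_gt_three])

/-- With too few rows the Hamming distance cannot approximate distances on the scale `δ`, since it
takes only multiples of a large number. -/
lemma exists_hamming_far_of_coarse {m n r : ℕ} {δ ε lam : ℝ} (hr : 0 < r) (hrn : r ≤ n)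
    (hδ : 0 < δ) (hδ1 : δ ≤ 1 / 2) (hε : 0 ≤ ε)
    (hm : m = 0 ∨ 4 * δ ≤ √(2 * π) * lam / m) (A : Fin m → Fin n → ℝ) (τ : Fin m → ℝ) :
    ∃ x ∈ cylSet n r ε, ∃ y ∈ cylSet n r ε,
      |√(2 * π) * lam / m * (hamming (signVec (mulVecR A x + τ)) (signVec (mulVecR A y + τ)) : ℝ)
        - enorm2 (x - y)| ≥ 2 * δ := by
  classical
  set i0 : Fin n := ⟨0, by omega⟩ with hi0
  have hlow : i0 ∈ lowIdx n r := by simp [lowIdx, hi0, hr]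
  have hhigh : i0 ∉ highIdx n r := by simp [highIdx, hi0]; omega
  set x : Fin n → ℝ := fun i => if i = i0 then 2 * δ else 0 with hx
  have hx2 : ∀ i, x i ^ 2 = if i = i0 then (2 * δ) ^ 2 else 0 := fun i => by
    by_cases h : i = i0 <;> simp [hx, h]
  have hnx : enorm2 (x - 0) = 2 * δ := by
    rw [sub_zero, enorm2]
    simp only [hx2, Finset.sum_ite_eq', Finset.mem_univ, if_true]
    exact Real.sqrt_sq (by linarith)
  refine ⟨x, ?_, 0, ?_, ?_⟩
  · rw [mem_cylSet]
    unfold normOn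
    simp only [hx2, Finset.sum_ite_eq', hlow, hhigh, if_true, if_false]
    rw [Real.sqrt_sq (by linarith), Real.sqrt_zero]
    exact ⟨by linarith, hε⟩
  · simp [mem_cylSet, normOn, hε]
  · rw [hnx]
    set h : ℕ := hamming (signVec (mulVecR A x + τ)) (signVec (mulVecR A 0 + τ)) with hh
    have hz : √(2 * π) * lam / m * (h : ℝ) = 0 →
        |√(2 * π) * lam / m * (h : ℝ) - 2 * δ| ≥ 2 * δ := by
      intro h0
      rw [h0, zero_sub, abs_neg, abs_of_pos (by linarith)]
    rcases hm with hm | hm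
    · exact hz (by simp [hm])
    · rcases Nat.eq_zero_or_pos h with h0 | h0
      · exact hz (by simp [h0])
      · have h1 : (1 : ℝ) ≤ h := by exact_mod_cast h0
        refine le_trans ?_ (le_abs_self _)
        nlinarith

set_option maxHeartbeats 400000 in
theorem nonuniform_hamming_estimate {r m n : ℕ} {δ ε lam L : ℝ} (hr : 0 < r) (hrn : r ≤ n)
    (hδ : 0 < δ) (hδ1 : δ ≤ 1 / 1000) (hL : L = Real.log (Real.exp 1 / δ))
    (hε : ε = 1 / 4000 * δ / L) (hn : r * L ^ 2 / δ ^ 2 ≤ n + 1) (hlam : lam = 2 * √L)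
    (hm : (m : ℝ) ≤ 4 / 10 ^ 18 * √L * r / δ ^ 3) :
    ENNReal.ofReal 0.9 ≤ ((gaussianMatrix m n).prod (unifCube m lam))
      {p | ∃ x ∈ cylSet n r ε, ∃ y ∈ cylSet n r ε,
        |√(2 * π) * lam / m * (hamming (signVec (mulVecR p.1 x + p.2))
          (signVec (mulVecR p.1 y + p.2)) : ℝ) - enorm2 (x - y)| ≥ 2 * δ} := by
  obtain ⟨hL1, -, -⟩ := log_exp_one_div_facts hδ (by linarith)
  rw [← hL] at hL1
  set s := √L with hs
  have hs1 : 1 ≤ s := Real.one_le_sqrt.2 hL1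
  have hs2 : s ^ 2 = L := Real.sq_sqrt (by linarith)
  have hl : 0 < lam := by rw [hlam]; linarith
  have hL0 : 0 < L := by linarith
  have hε0 : 0 < ε := by rw [hε]; positivity
  have hεδ : ε ≤ δ := by
    rw [hε, div_le_iff₀ hL0]
    nlinarith
  have hr1 : (1 : ℝ) ≤ r := by exact_mod_cast hr
  have hpi := two_le_sqrt_two_pi
  have := isProbabilityMeasure_unifIcc hl
  have hprob : IsProbabilityMeasure (unifCube m lam) := by
    rw [unifCube_eq_pi m hl]; infer_instance
  set G : Set ((Fin m → Fin n → ℝ) × (Fin m → ℝ)) := {p | ∃ x ∈ cylSet n r ε, ∃ y ∈ cylSet n r ε,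
    |√(2 * π) * lam / m * (hamming (signVec (mulVecR p.1 x + p.2))
      (signVec (mulVecR p.1 y + p.2)) : ℝ) - enorm2 (x - y)| ≥ 2 * δ} with hG
  by_cases hcase : m = 0 ∨ 4 * δ ≤ √(2 * π) * lam / m
  · have : G = Set.univ := Set.eq_univ_of_forall fun p =>
      exists_hamming_far_of_coarse hr hrn hδ (by linarith) hε0.le hcase p.1 p.2
    rw [this, measure_univ, ← ENNReal.ofReal_one]
    exact ENNReal.ofReal_le_ofReal (by norm_num)
  rw [not_or, not_le] at hcase
  obtain ⟨hm0, hcoarse⟩ := hcase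
  have hmpos : (0 : ℝ) < m := by exact_mod_cast Nat.pos_of_ne_zero hm0
  rw [div_lt_iff₀ hmpos] at hcoarse
  set θ := 160 * δ with hθ
  have hθl : θ ≤ lam := by rw [hlam]; linarith
  set q : ℝ := m * (θ / lam) with hq
  have hq80 : 80 ≤ q := by
    rw [hq, hθ, mul_div_assoc', le_div_iff₀ hl]
    nlinarith
  have hqval : q = 80 * m * δ / s := by rw [hq, hθ, hlam]; field_simp; norm_num
  have hqle : q ≤ 320 / 10 ^ 18 * (r / δ ^ 2) := by
    rw [hqval]
    calc 80 * m * δ / s ≤ 80 * (4 / 10 ^ 18 * s * r / δ ^ 3) * δ / s := by gcongr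
      _ = _ := by field_simp; norm_num
  set N : ℝ := ((highIdx n r).card : ℝ) with hNdef
  have hNn : N + r = n := by
    have := card_highIdx n r
    rw [card_lowIdx hrn] at this
    rw [hNdef]; exact_mod_cast this
  have hrδ : 10 ^ 6 * (r : ℝ) ≤ r / δ ^ 2 := by
    rw [le_div_iff₀ (by positivity)]
    have : δ ^ 2 ≤ (1 / 1000) ^ 2 := by gcongr
    nlinarith
  have hrL : (r : ℝ) / δ ^ 2 ≤ r * L ^ 2 / δ ^ 2 := by
    gcongr
    exact le_mul_of_one_le_right (Nat.cast_nonneg r) (one_le_pow₀ hL1)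
  have hNlow : r * L ^ 2 / δ ^ 2 / 2 ≤ N := by linarith
  have hNlow' : (r : ℝ) / δ ^ 2 / 2 ≤ N := by linarith
  have hN0 : 0 < N := by
    have : 0 < (r : ℝ) / δ ^ 2 := by positivity
    linarith
  have hJ : (highIdx n r).Nonempty := by
    rw [← Finset.card_pos, ← Nat.cast_pos (α := ℝ)]; exact hN0
  have hεN : (r : ℝ) / (4 * 10 ^ 7) ≤ ε ^ 2 * N := by
    calc (r : ℝ) / (4 * 10 ^ 7) ≤ r / 32000000 := by gcongr; norm_num
      _ = ε ^ 2 * (r * L ^ 2 / δ ^ 2 / 2) := by rw [hε]; field_simp; norm_num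
      _ ≤ _ := by gcongr
  classical
  set I : Finset (Finset (Fin m)) :=
    Finset.univ.filter fun S => |(S.card : ℝ) - q| < q / 2 with hI
  set B : Finset (Fin m) → Set (Fin m → Fin n → ℝ) := fun S =>
    {A | 100 * (S.card * N) ≤ normOn (highIdx n r) (rowComb (indVec S) A) ^ 2 ∨
      S.card * N ^ 2 / 8 ≤
        ∑ i ∈ S, (∑ l ∈ highIdx n r, A i l * rowComb (indVec S) A l - N) ^ 2} with hBdef
  have hcardI : ∀ S ∈ I, q / 2 < S.card ∧ (S.card : ℝ) < 3 / 2 * q := fun S hS => by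
    have := abs_lt.1 (Finset.mem_filter.1 hS).2
    constructor <;> linarith
  have hne : ∀ S ∈ I, S.Nonempty := fun S hS => by
    rw [← Finset.card_pos]
    have : (0 : ℝ) < S.card := by linarith [(hcardI S hS).1]
    exact_mod_cast this
  have hbad : ((gaussianMatrix m n).prod (unifCube m lam))
      {p | p.1 ∈ B (smallDither θ p.2) ∨ smallDither θ p.2 ∉ I} ≤
      ENNReal.ofReal 0.05 + ENNReal.ofReal 0.05 := by
    refine prod_measure_random_index_le _ _ (measurableSet_smallDither_eq θ) B I ?_ ?_
    · intro S hS
      refine (gaussianMatrix_row_sum_bad_le (hne S hS) hJ).trans (ENNReal.ofReal_le_ofReal ?_)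
      have h1 : 640 * (S.card : ℝ) / N ≤ 0.04 := by
        rw [div_le_iff₀ hN0]
        linarith [(hcardI S hS).2]
      linarith
    · refine le_trans (le_of_eq ?_)
        (unifCube_card_smallDither_le hl (by positivity) hθl (by rw [← hq]; exact hq80))
      congr 1
      ext τ
      simp [hI, hq]
  have hcover : (Set.univ : Set ((Fin m → Fin n → ℝ) × (Fin m → ℝ))) ⊆
      G ∪ {p | p.1 ∈ B (smallDither θ p.2) ∨ smallDither θ p.2 ∉ I} := by
    rintro ⟨A, τ⟩ -
    by_cases hp : A ∈ B (smallDither θ τ) ∨ smallDither θ τ ∉ I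
    · exact Or.inr hp
    left
    rw [not_or, not_not] at hp
    obtain ⟨hA, hSI⟩ := hp
    obtain ⟨hk1, hk2⟩ := hcardI _ hSI
    rw [hBdef, Set.mem_ofPred_eq, not_or, not_le, not_le] at hA
    have hθN : 400 * ((smallDither θ τ).card : ℝ) * θ ^ 2 < ε ^ 2 * N := by
      calc 400 * ((smallDither θ τ).card : ℝ) * θ ^ 2
          ≤ 400 * (3 / 2 * (320 / 10 ^ 18 * ((r : ℝ) / δ ^ 2))) * θ ^ 2 := by gcongr; linarith
        _ = 400 * (3 / 2 * (320 / 10 ^ 18)) * 160 ^ 2 * (r : ℝ) := by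
            rw [hθ]; field_simp
        _ < r / (4 * 10 ^ 7) := by linarith
        _ ≤ _ := hεN
    obtain ⟨x, hx, y, hy, hxy, hham⟩ := exists_separated_of_rows A τ (hne _ hSI) hJ hε0
      (fun i hi => (Finset.mem_filter.1 hi).2) hθN hA.1 hA.2
    refine ⟨x, hx, y, hy, le_trans ?_ (le_abs_self _)⟩
    have h1 : 40 * δ ≤ √(2 * π) * lam / m * (q / 4) := by
      rw [hq]
      calc 40 * δ ≤ √(2 * π) * (40 * δ) := by nlinarith
        _ = _ := by rw [hθ]; field_simp; norm_num
    have h2 : √(2 * π) * lam / m * (q / 4) ≤ √(2 * π) * lam / m *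
        (hamming (signVec (mulVecR A x + τ)) (signVec (mulVecR A y + τ)) : ℝ) := by
      gcongr
      linarith
    linarith
  have htot : ENNReal.ofReal 0.9 + ENNReal.ofReal 0.1 ≤
      ((gaussianMatrix m n).prod (unifCube m lam)) G + ENNReal.ofReal 0.1 := by
    rw [← ENNReal.ofReal_add (by norm_num) (by norm_num),
      show (0.9 + 0.1 : ℝ) = 1 by norm_num, ENNReal.ofReal_one,
      ← measure_univ (μ := (gaussianMatrix m n).prod (unifCube m lam))]
    refine (measure_mono hcover).trans ((measure_union_le _ _).trans ?_)
    gcongr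
    refine hbad.trans (le_of_eq ?_)
    rw [← ENNReal.ofReal_add (by norm_num) (by norm_num)]
    norm_num
  exact (ENNReal.add_le_add_iff_right ENNReal.ofReal_ne_top).1 htot

/-- Theorem 4.4: the counterexample set E, for which m ≍ √(log(e/δ))·ℓ_*²(E)/δ³ is both
necessary and sufficient. -/
theorem counterexample_set :
    ∃ c0 c1 c2 η C c : ℝ,
      0 < c0 ∧ 0 < c1 ∧ 0 < c2 ∧ 0 < η ∧ 0 < C ∧ 0 < c ∧
      ∀ (r m : ℕ) (δ ε lam : ℝ) (n : ℕ),
        0 < r → 0 < δ → δ ≤ c0 →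
        ε = c * δ / Real.log (Real.exp 1 / δ) →
        n = ⌊η * r / ε^2⌋₊ →
        lam = C * Real.sqrt (Real.log (Real.exp 1 / δ)) →
        (((m : ℝ) ≤ c1 * Real.sqrt (Real.log (Real.exp 1 / δ)) *
              (meanWidth (cylSet n r ε))^2 / δ^3 →
          ENNReal.ofReal 0.9 ≤
            ((gaussianMatrix m n).prod (unifCube m lam))
              {p | ∃ x ∈ cylSet n r ε, ∃ y ∈ cylSet n r ε,
                |Real.sqrt (2 * Real.pi) * lam / m *
                    (hamming (signVec (mulVecR p.1 x + p.2)) (signVec (mulVecR p.1 y + p.2)) : ℝ)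
                  - enorm2 (x - y)| ≥ 2 * δ}) ∧
        ((m : ℝ) ≥ c2 * Real.sqrt (Real.log (Real.exp 1 / δ)) *
              (meanWidth (cylSet n r ε))^2 / δ^3 →
          ENNReal.ofReal 0.9 ≤
            ((gaussianMatrix m n).prod (unifCube m lam))
              {p | ∀ x ∈ cylSet n r ε, ∀ y ∈ cylSet n r ε,
                |Real.sqrt (2 * Real.pi) * lam / m *
                    (hamming (signVec (mulVecR p.1 x + p.2)) (signVec (mulVecR p.1 y + p.2)) : ℝ)
                  - enorm2 (x - y)| ≤ δ})) := by
  refine ⟨1 / 1000, 1 / 10 ^ 18, 10 ^ 7, (1 / 4000) ^ 2, 2, 1 / 4000, by norm_num, by norm_num,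
    by norm_num, by norm_num, by norm_num, by norm_num, ?_⟩
  intro r m δ ε lam n hr hδ hδ1 hε hn hlam
  obtain ⟨hL1, -, -⟩ := log_exp_one_div_facts hδ (by linarith)
  set L := Real.log (Real.exp 1 / δ) with hL
  have hL0 : 0 < L := by linarith
  have hε0 : 0 < ε := by rw [hε]; positivity
  have hr0 : (0 : ℝ) < r := by exact_mod_cast hr
  have hval : (1 / 4000) ^ 2 * (r : ℝ) / ε ^ 2 = r * L ^ 2 / δ ^ 2 := by
    rw [hε]; field_simp
  have hnle : (n : ℝ) ≤ r * L ^ 2 / δ ^ 2 := by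
    rw [hn, ← hval]
    exact Nat.floor_le (by positivity)
  have hnlt : r * L ^ 2 / δ ^ 2 ≤ (n : ℝ) + 1 := by
    rw [hn, ← hval]
    exact (Nat.lt_floor_add_one _).le
  have hrn : r ≤ n := by
    rw [hn, hval]
    refine Nat.le_floor ?_
    rw [le_div_iff₀ (by positivity)]
    have h1 : δ ^ 2 ≤ 1 := pow_le_one₀ hδ.le (by linarith)
    have h2 : 1 ≤ L ^ 2 := one_le_pow₀ hL1
    exact mul_le_mul_of_nonneg_left (h1.trans h2) hr0.le
  have hεn : ε ^ 2 * n ≤ r := by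
    calc ε ^ 2 * n ≤ ε ^ 2 * ((1 / 4000) ^ 2 * (r : ℝ) / ε ^ 2) := by rw [hval]; gcongr
      _ = (1 / 4000) ^ 2 * (r : ℝ) := by field_simp
      _ ≤ r := by linarith
  have hup := meanWidth_cylSet_sq_le hr hrn hε0.le hεn
  have hlo := le_meanWidth_cylSet_sq hrn hε0.le
  constructor
  · intro hm
    refine nonuniform_hamming_estimate hr hrn hδ hδ1 hL hε hnlt hlam (hm.trans ?_)
    calc 1 / 10 ^ 18 * √L * meanWidth (cylSet n r ε) ^ 2 / δ ^ 3
        ≤ 1 / 10 ^ 18 * √L * (4 * r) / δ ^ 3 := by gcongr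
      _ = 4 / 10 ^ 18 * √L * r / δ ^ 3 := by ring
  · intro hm
    refine uniform_hamming_estimate hr hδ hδ1 hL hε hnle hlam (le_trans ?_ hm)
    calc 5 * 10 ^ 6 * √L * r / δ ^ 3 = 10 ^ 7 * √L * (r / 2) / δ ^ 3 := by ring
      _ ≤ 10 ^ 7 * √L * meanWidth (cylSet n r ε) ^ 2 / δ ^ 3 := by gcongr

end
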